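/- For every positive integer n, the crossing number of the complete tripartite graph K_{2,3,n} equals Z(5,n+2) − 3n. -/

import Mathlib

open SimpleGraph

variable {V : Type*}

/-- A drawing of a simple graph in the plane: an injective placement of the
vertices in `ℝ²` together with, for each edge, a continuous arc joining the
positions of its endpoints (parametrised compatibly in both directions),
such that no arc passes through the position of a vertex other than its
endpoints. -/
structure Drawing (G : SimpleGraph V) where
  pos : V → ℝ × ℝ
  pos_inj : Function.Injective pos
  arc : V → V → ℝ → ℝ × ℝ
  arc_cont : ∀ ⦃a b⦄, G.Adj a b → ContinuousOn (arc a b) (Set.Icc 0 1)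
  arc_zero : ∀ ⦃a b⦄, G.Adj a b → arc a b 0 = pos a
  arc_one : ∀ ⦃a b⦄, G.Adj a b → arc a b 1 = pos b
  arc_symm : ∀ ⦃a b⦄, G.Adj a b → ∀ t, arc b a t = arc a b (1 - t)
  arc_avoid : ∀ ⦃a b⦄, G.Adj a b → ∀ c, c ≠ a → c ≠ b →
      pos c ∉ arc a b '' Set.Icc 0 1

namespace Drawing

variable {G : SimpleGraph V} (D : Drawing G)

/-- The set of points of the plane used by the edge `e`. -/
def edgePoints (e : Sym2 V) : Set (ℝ × ℝ) :=
  {p | ∃ a b, e = s(a, b) ∧ G.Adj a b ∧ p ∈ D.arc a b '' Set.Icc 0 1}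

/-- The positions of the endpoints of an edge. -/
def ends (e : Sym2 V) : Set (ℝ × ℝ) := {p | ∃ a ∈ e, p = D.pos a}

/-- `p` is a crossing of the (distinct) edges `e` and `f` in the drawing `D`:
a common point of the two edges other than an endpoint. -/
def IsCrossing (e f : Sym2 V) (p : ℝ × ℝ) : Prop :=
  e ∈ G.edgeSet ∧ f ∈ G.edgeSet ∧ e ≠ f ∧
    p ∈ D.edgePoints e ∧ p ∈ D.edgePoints f ∧ p ∉ D.ends e ∧ p ∉ D.ends f

/-- The crossings between an edge of `A` and an edge of `B`: a crossing is
recorded as a point of the plane together with the unordered pair of edges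
crossing there. -/
def crossings (A B : Set (Sym2 V)) : Set ((ℝ × ℝ) × Sym2 (Sym2 V)) :=
  {q | ∃ e f, q.2 = s(e, f) ∧ e ∈ A ∧ f ∈ B ∧ D.IsCrossing e f q.1}

/-- `cr_D(A, B)`: the number of crossings between an edge of `A` and an
edge of `B`. -/
noncomputable def crBetween (A B : Set (Sym2 V)) : ℕ := Nat.card (D.crossings A B)

/-- `cr(D)`: the total number of crossings of the drawing `D`. -/
noncomputable def crNum : ℕ := D.crBetween G.edgeSet G.edgeSet

/-- A good drawing: no edge crosses itself (each arc is a simple arc),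
no two adjacent edges cross, no two edges cross more than once, and no three
edges cross at a common point. -/
structure IsGood : Prop where
  arc_inj : ∀ ⦃a b⦄, G.Adj a b → Set.InjOn (D.arc a b) (Set.Icc 0 1)
  adj_no_cross : ∀ e f : Sym2 V, (∃ a, a ∈ e ∧ a ∈ f) → ∀ p, ¬ D.IsCrossing e f p
  cross_once : ∀ e f : Sym2 V, {p | D.IsCrossing e f p}.Subsingleton
  no_triple : ∀ p, ∀ e f g : Sym2 V, e ≠ f → e ≠ g → f ≠ g →
      ¬ (D.IsCrossing e f p ∧ D.IsCrossing f g p ∧ D.IsCrossing e g p)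

end Drawing

/-- The crossing number of a graph: the minimum number of crossings among
all good drawings of `G` in the plane. -/
noncomputable def crossingNumber (G : SimpleGraph V) : ℕ :=
  sInf {n | ∃ D : Drawing G, D.IsGood ∧ D.crNum = n}

/-- The Zarankiewicz function `Z(m,n) = ⌊m/2⌋⌊(m-1)/2⌋⌊n/2⌋⌊(n-1)/2⌋`. -/
def Z (m n : ℕ) : ℕ := m / 2 * ((m - 1) / 2) * (n / 2) * ((n - 1) / 2)

/-- The complete bipartite graph `K_{a,b}`. -/
abbrev bipK (a b : ℕ) : SimpleGraph (Fin a ⊕ Fin b) :=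
  completeBipartiteGraph (Fin a) (Fin b)

/-- The complete tripartite graph `K_{a,b,c}`. -/
abbrev triK (a b c : ℕ) : SimpleGraph (Σ i : Fin 3, ![Fin a, Fin b, Fin c] i) :=
  completeMultipartiteGraph ![Fin a, Fin b, Fin c]

/-- The complete 4-partite graph `K_{a,b,c,d}`. -/
abbrev quadK (a b c d : ℕ) : SimpleGraph (Σ i : Fin 4, ![Fin a, Fin b, Fin c, Fin d] i) :=
  completeMultipartiteGraph ![Fin a, Fin b, Fin c, Fin d]

/-- `E(V₁, V₂)`: the set of pairs `{v₁, v₂}` with `v₁ ∈ V₁` and `v₂ ∈ V₂`. -/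
def pairEdges {α : Type*} (V₁ V₂ : Set α) : Set (Sym2 α) :=
  {e | ∃ a ∈ V₁, ∃ b ∈ V₂, e = s(a, b)}

section
open Complex

/-- complex log change of a nonvanishing function between parameters. -/
noncomputable def cang (f : ℝ → ℂ) (a b : ℝ) : ℂ :=
  open Classical in
  if h : ∃ L : ℝ → ℂ, Continuous L ∧ ∀ t, exp (L t) = f t then
    h.choose b - h.choose a else 0

theorem lift_exists {A : Type*} [TopologicalSpace A] [SimplyConnectedSpace A]
    [LocallyPathConnectedSpace A] (f : A → ℂ) (hf : Continuous f) (h0 : ∀ t, f t ≠ 0) :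
    ∃ L : A → ℂ, Continuous L ∧ ∀ t, exp (L t) = f t := by
  obtain ⟨a₀⟩ : Nonempty A := inferInstance
  obtain ⟨F, ⟨-, hF⟩, -⟩ := Complex.isCoveringMapOn_exp.existsUnique_continuousMap_lifts
    ⟨f, hf⟩ (a₀ := a₀) (e₀ := log (f a₀)) (by simpa using exp_log (h0 a₀)) (by simpa using h0)
  exact ⟨F, F.continuous, fun t => congrFun hF t⟩

theorem lift_unique {L M : ℝ → ℂ} (hL : Continuous L) (hM : Continuous M)
    (h : ∀ t, exp (L t) = exp (M t)) (a b : ℝ) : L b - L a = M b - M a := by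
  have hc := Complex.isCoveringMap_exp.eq_of_comp_eq (g₁ := L)
    (g₂ := fun t => M t + (L a - M a)) hL (by fun_prop) (by
      funext t
      apply Subtype.ext
      simp [exp_add, exp_sub, h]) a (by simp)
  have := congrFun hc b
  rw [this]; ring

theorem cang_eq {f : ℝ → ℂ} {L : ℝ → ℂ} (hL : Continuous L) (h : ∀ t, exp (L t) = f t)
    (a b : ℝ) : cang f a b = L b - L a := by
  have hex : ∃ L : ℝ → ℂ, Continuous L ∧ ∀ t, exp (L t) = f t := ⟨L, hL, h⟩
  rw [cang, dif_pos hex]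
  exact lift_unique hex.choose_spec.1 hL (fun t => by rw [hex.choose_spec.2, h]) a b

theorem cang_exp {f : ℝ → ℂ} (hf : Continuous f) (h0 : ∀ t, f t ≠ 0) (a b : ℝ) :
    exp (cang f a b) = f b / f a := by
  obtain ⟨L, hL, h⟩ := lift_exists f hf h0
  rw [cang_eq hL h, exp_sub, h, h]

theorem cang_add {f : ℝ → ℂ} (hf : Continuous f) (h0 : ∀ t, f t ≠ 0) (a b c : ℝ) :
    cang f a b + cang f b c = cang f a c := by
  obtain ⟨L, hL, h⟩ := lift_exists f hf h0
  simp only [cang_eq hL h]; ring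

theorem cang_swap {f : ℝ → ℂ} (hf : Continuous f) (h0 : ∀ t, f t ≠ 0) (a b : ℝ) :
    cang f b a = - cang f a b := by
  obtain ⟨L, hL, h⟩ := lift_exists f hf h0
  simp only [cang_eq hL h]; ring

theorem cang_comp {f : ℝ → ℂ} (hf : Continuous f) (h0 : ∀ t, f t ≠ 0) {φ : ℝ → ℝ}
    (hφ : Continuous φ) (a b : ℝ) :
    cang (fun t => f (φ t)) a b = cang f (φ a) (φ b) := by
  obtain ⟨L, hL, h⟩ := lift_exists f hf h0
  rw [cang_eq hL h, cang_eq (hL.comp hφ) (fun t => h (φ t))]; rfl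

/-- log change of `α - p` -/
noncomputable def tang (α : ℝ → ℂ) (p : ℂ) (a b : ℝ) : ℂ := cang (fun t => α t - p) a b

theorem tang_comp {α : ℝ → ℂ} {p : ℂ} (hf : Continuous α) (h0 : ∀ t, α t ≠ p) {φ : ℝ → ℝ}
    (hφ : Continuous φ) (a b : ℝ) :
    tang (fun t => α (φ t)) p a b = tang α p (φ a) (φ b) :=
  cang_comp (f := fun t => α t - p) (by fun_prop) (fun t => sub_ne_zero.2 (h0 t)) hφ a b

theorem tang_exp {α : ℝ → ℂ} {p : ℂ} (hf : Continuous α) (h0 : ∀ t, α t ≠ p) (a b : ℝ) :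
    exp (tang α p a b) = (α b - p) / (α a - p) :=
  cang_exp (f := fun t => α t - p) (by fun_prop) (fun t => sub_ne_zero.2 (h0 t)) a b

theorem tang_add {α : ℝ → ℂ} {p : ℂ} (hf : Continuous α) (h0 : ∀ t, α t ≠ p) (a b c : ℝ) :
    tang α p a b + tang α p b c = tang α p a c :=
  cang_add (f := fun t => α t - p) (by fun_prop) (fun t => sub_ne_zero.2 (h0 t)) a b c

theorem tang_swap {α : ℝ → ℂ} {p : ℂ} (hf : Continuous α) (h0 : ∀ t, α t ≠ p) (a b : ℝ) :
    tang α p b a = - tang α p a b :=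
  cang_swap (f := fun t => α t - p) (by fun_prop) (fun t => sub_ne_zero.2 (h0 t)) a b

theorem square {α β : ℝ → ℂ} (hα : Continuous α) (hβ : Continuous β) (h : ∀ s t, α s ≠ β t)
    (a b c d : ℝ) :
    tang α (β c) a b + tang β (α b) c d - tang α (β d) a b - tang β (α a) c d = 0 := by
  obtain ⟨F, hF, h1⟩ := lift_exists (fun x : ℝ × ℝ => α x.1 - β x.2) (by fun_prop)
    (fun x => sub_ne_zero.2 (h _ _))
  have e1 : ∀ c, tang α (β c) a b = F (b, c) - F (a, c) := fun c =>
    cang_eq (L := fun s => F (s, c)) (by fun_prop) (fun s => h1 (s, c)) a b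
  have e2 : ∀ a, tang β (α a) c d = F (a, d) - F (a, c) := fun a => by
    have := cang_eq (f := fun t => β t - α a) (L := fun s => F (a, s) + Real.pi * I) (by fun_prop)
      (fun s => by rw [exp_add, h1, exp_pi_mul_I]; ring) c d
    rw [tang, this]; ring
  simp only [e1, e2]; ring

theorem square_int {α β : ℝ → ℂ} (hα : Continuous α) (hβ : Continuous β) {a b c d : ℝ}
    (h1 : ∀ s, α s ≠ β c) (h2 : ∀ s, α s ≠ β d) (h3 : ∀ s, β s ≠ α a) (h4 : ∀ s, β s ≠ α b) :
    ∃ m : ℤ, tang α (β c) a b + tang β (α b) c d - tang α (β d) a b - tang β (α a) c d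
      = m * (2 * Real.pi * I) := by
  apply Complex.exp_eq_one_iff.1
  rw [exp_sub, exp_sub, exp_add, tang_exp hα h1, tang_exp hα h2, tang_exp hβ h3, tang_exp hβ h4]
  have := sub_ne_zero.2 (h1 a)
  have := sub_ne_zero.2 (h1 b)
  have := sub_ne_zero.2 (h2 a)
  have := sub_ne_zero.2 (h2 b)
  have := sub_ne_zero.2 (h3 c)
  have := sub_ne_zero.2 (h3 d)
  have := sub_ne_zero.2 (h4 c)
  have := sub_ne_zero.2 (h4 d)
  have e1 : β c - α a = -(α a - β c) := by ring
  have e2 : β d - α a = -(α a - β d) := by ring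
  have e3 : β c - α b = -(α b - β c) := by ring
  have e4 : β d - α b = -(α b - β d) := by ring
  rw [e1, e2, e3, e4]
  field_simp

end

section
open Complex

noncomputable def zz (α β : ℝ → ℂ) (s t : ℝ) : ℂ := tang α (β t) 0 s - tang β (α s) 0 t

/-- two arcs from the same point meeting nowhere else -/
def Fan (α β : ℝ → ℂ) : Prop := ∀ s t, (0 < s ∨ 0 < t) → α s ≠ β t

theorem Fan.symm {α β : ℝ → ℂ} (h : Fan α β) : Fan β α := fun s t hst => (h t s hst.symm).symm

theorem zz_antisymm (α β : ℝ → ℂ) (s t : ℝ) : zz β α t s = - zz α β s t := by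
  simp [zz]

theorem zz_diff {α β : ℝ → ℂ} (hα : Continuous α) (hβ : Continuous β) (h : Fan α β)
    {s₁ s t : ℝ} (h1 : 0 < s₁) (h2 : s₁ ≤ s) (ht : 0 < t) :
    zz α β s t - zz α β s₁ t = tang (fun τ => α (max s₁ τ)) (β 0) s₁ s := by
  have hm : Continuous (fun τ : ℝ => max s₁ τ) := by fun_prop
  have sq := square (α := fun τ => α (max s₁ τ)) (by fun_prop) hβ
    (fun x y => h _ _ (Or.inl (lt_of_lt_of_le h1 (le_max_left _ _)))) s₁ s 0 t
  have e1 : tang (fun τ => α (max s₁ τ)) (β t) s₁ s = tang α (β t) s₁ s := by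
    rw [tang_comp hα (fun x => h _ _ (Or.inr ht)) hm]; simp [h2]
  have e2 := tang_add hα (p := β t) (fun x => h _ _ (Or.inr ht)) 0 s₁ s
  simp only [max_self, max_eq_right h2] at sq
  rw [e1] at sq
  simp only [zz]
  rw [← e2]
  linear_combination -sq

theorem tang_small {α : ℝ → ℂ} (hα : Continuous α) {v p : ℂ} {s : ℝ} (hs : 0 < s) (h0 : α 0 = v)
    (hp : ∀ τ, α τ ≠ p) (hr : ∀ τ, 0 ≤ τ → τ ≤ s → ‖α τ - v‖ ≤ ‖p - v‖) :
    |(tang α p 0 s).im| < Real.pi / 2 := by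
  have hpv : p - v ≠ 0 := by
    rw [sub_ne_zero, ← h0]; exact (hp 0).symm
  let φ : ℝ → ℝ := fun τ => max 0 (min s τ)
  have hφ : Continuous φ := by fun_prop
  have hφ0 : ∀ τ, 0 ≤ φ τ := fun τ => le_max_left _ _
  have hφ1 : ∀ τ, φ τ ≤ s := fun τ => max_le hs.le (min_le_left _ _)
  have e1 : tang α p 0 s = tang (fun τ => α (φ τ)) p 0 s := by
    rw [tang_comp hα hp hφ]; simp [φ, hs.le]
  let g : ℝ → ℂ := fun τ => (α (φ τ) - p) / (v - p)
  have hvp : v - p ≠ 0 := by rw [← neg_sub]; exact neg_ne_zero.2 hpv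
  have hg : ∀ τ, 0 < (g τ).re := by
    intro τ
    set w := (α (φ τ) - v) / (p - v) with hw
    have e : g τ = 1 - w := by
      simp only [g, hw]
      have : v - p = -(p - v) := by ring
      rw [this]
      field_simp
      ring
    have hw1 : ‖w‖ ≤ 1 := by
      rw [hw, norm_div, div_le_one (norm_pos_iff.2 hpv)]
      exact hr _ (hφ0 τ) (hφ1 τ)
    have hne : w ≠ 1 := by
      intro h
      rw [hw, div_eq_one_iff_eq hpv] at h
      exact hp (φ τ) (by linear_combination h)
    rw [e, sub_re, one_re]
    by_contra hcon
    have h3 : 1 ≤ w.re := by linarith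
    apply hne
    have h4 := (Complex.normSq_eq_norm_sq w).symm
    rw [normSq_apply] at h4
    have h6 : ‖w‖ ^ 2 ≤ 1 := by nlinarith [norm_nonneg w]
    have h5 : w.im = 0 := by
      have : w.im * w.im ≤ 0 := by nlinarith
      nlinarith [mul_self_nonneg w.im]
    have h7 : w.re = 1 := by nlinarith
    exact Complex.ext (by simpa using h7) (by simpa using h5)
  have hgc : Continuous g := by fun_prop
  have hlog : Continuous (fun τ => log (g τ)) := hgc.clog (fun τ => Or.inl (hg τ))
  have e2 : tang (fun τ => α (φ τ)) p 0 s = (log (g s) + log (v - p)) - (log (g 0) + log (v-p)) := by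
    refine cang_eq (L := fun τ => log (g τ) + log (v - p)) (by fun_prop) (fun τ => ?_) 0 s
    rw [exp_add, exp_log, exp_log hvp]
    · simp only [g]; field_simp
    · intro h; have := hg τ; rw [h] at this; simp at this
  have g0 : g 0 = 1 := by simp [g, φ, hs.le, h0, hvp]
  rw [e1, e2, g0, log_one]
  simp only [zero_add, add_sub_cancel_right, log_im]
  exact abs_arg_lt_pi_div_two_iff.2 (Or.inl (hg s))

theorem first_hit {α : ℝ → ℂ} (hα : Continuous α) {r : ℝ} (hr : 0 < r)
    (h1 : r ≤ ‖α 1 - α 0‖) :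
    ∃ s, 0 < s ∧ s ≤ 1 ∧ ‖α s - α 0‖ = r ∧ ∀ τ, 0 ≤ τ → τ ≤ s → ‖α τ - α 0‖ ≤ r := by
  have hc : Continuous (fun τ => ‖α τ - α 0‖) := by fun_prop
  obtain ⟨s, ⟨⟨hs0, hs1⟩, hs⟩, hmin⟩ :=
    (isCompact_Icc.inter_right (isClosed_le continuous_const hc)
      : IsCompact (Set.Icc (0 : ℝ) 1 ∩ {τ | r ≤ ‖α τ - α 0‖})).exists_isLeast
      ⟨1, ⟨by simp, by simpa using h1⟩⟩
  simp only [Set.mem_ofPred_eq] at hs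
  have hle : ∀ τ, 0 ≤ τ → τ < s → ‖α τ - α 0‖ < r := by
    intro τ h0 h
    by_contra hcon
    exact absurd (hmin ⟨⟨h0, by linarith⟩, not_lt.1 hcon⟩) (not_le.2 h)
  have heq : ‖α s - α 0‖ = r := by
    obtain ⟨τ, ⟨h2, h3⟩, h4⟩ := intermediate_value_Icc hs0 hc.continuousOn
      (show r ∈ Set.Icc _ _ from ⟨by simpa using hr.le, hs⟩)
    simp only at h4
    rcases h3.lt_or_eq with h | h
    · exact absurd h4 (hle τ h2 h).ne
    · rw [← h, h4]
  refine ⟨s, ?_, hs1, heq, fun τ h0 h => ?_⟩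
  · rcases hs0.lt_or_eq with h | h
    · exact h
    · rw [← h] at heq; simp at heq; linarith
  · rcases h.lt_or_eq with h | h
    · exact (hle τ h0 h).le
    · rw [h, heq]

theorem rot_lemma {α β γ : ℝ → ℂ} (hα : Continuous α) (hβ : Continuous β) (hγ : Continuous γ)
    (hab : Fan α β) (hbc : Fan β γ) (hca : Fan γ α) (h1 : α 0 = β 0) (h2 : β 0 = γ 0)
    (ha1 : α 1 ≠ α 0) (hb1 : β 1 ≠ β 0) (hc1 : γ 1 ≠ γ 0) :
    (zz α β 1 1 + zz β γ 1 1 + zz γ α 1 1).im = Real.pi ∨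
    (zz α β 1 1 + zz β γ 1 1 + zz γ α 1 1).im = - Real.pi := by
  set v := α 0 with hv
  obtain ⟨r, hr, hra, hrb, hrc⟩ : ∃ r > 0, r ≤ ‖α 1 - α 0‖ ∧ r ≤ ‖β 1 - β 0‖ ∧ r ≤ ‖γ 1 - γ 0‖ :=
    ⟨min ‖α 1 - α 0‖ (min ‖β 1 - β 0‖ ‖γ 1 - γ 0‖),
      lt_min (norm_pos_iff.2 (sub_ne_zero.2 ha1)) (lt_min (norm_pos_iff.2 (sub_ne_zero.2 hb1))
        (norm_pos_iff.2 (sub_ne_zero.2 hc1))), min_le_left _ _,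
      (min_le_right _ _).trans (min_le_left _ _), (min_le_right _ _).trans (min_le_right _ _)⟩
  obtain ⟨s, s0, s1, sr, sle⟩ := first_hit hα hr hra
  obtain ⟨t, t0, t1, tr, tle⟩ := first_hit hβ hr hrb
  obtain ⟨u, u0, u1, ur, ule⟩ := first_hit hγ hr hrc
  -- truncation
  have o1 : (0:ℝ) < 1 := one_pos
  have A1 := zz_diff hα hβ hab s0 s1 o1
  have A2 := zz_diff hα hγ hca.symm s0 s1 o1
  have B1 := zz_diff hβ hγ hbc t0 t1 o1
  have B2 := zz_diff hβ hα hab.symm t0 t1 s0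
  have C1 := zz_diff hγ hα hca u0 u1 s0
  have C2 := zz_diff hγ hβ hbc.symm u0 u1 t0
  rw [← h1] at A1 C2
  rw [← h2, ← h1] at A2 B1
  rw [zz_antisymm γ α, zz_antisymm γ α] at A2
  rw [zz_antisymm α β, zz_antisymm α β] at B2
  rw [zz_antisymm β γ, zz_antisymm β γ] at C2
  have key : zz α β 1 1 + zz β γ 1 1 + zz γ α 1 1 = zz α β s t + zz β γ t u + zz γ α u s := by
    linear_combination A1 - A2 + B1 - B2 + C1 - C2
  -- parity
  have hp : exp (zz α β 1 1 + zz β γ 1 1 + zz γ α 1 1) = -1 := by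
    have q : ∀ {α β : ℝ → ℂ}, Continuous α → Continuous β → Fan α β → exp (zz α β 1 1) =
        ((α 1 - β 1) / (α 0 - β 1)) / ((β 1 - α 1) / (β 0 - α 1)) := by
      intro α β h h' hh
      rw [zz, exp_sub, tang_exp h (fun x => hh _ _ (Or.inr one_pos)),
        tang_exp h' (fun x => hh.symm _ _ (Or.inr one_pos))]
    rw [exp_add, exp_add, q hα hβ hab, q hβ hγ hbc, q hγ hα hca, ← h2, ← h1, ← hv]
    have n1 : v - α 1 ≠ 0 := sub_ne_zero.2 ha1.symm
    have n2 : v - β 1 ≠ 0 := sub_ne_zero.2 (by rw [h1]; exact hb1.symm)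
    have n3 : v - γ 1 ≠ 0 := sub_ne_zero.2 (by rw [h1, h2]; exact hc1.symm)
    have m1 : α 1 - β 1 ≠ 0 := sub_ne_zero.2 (hab _ _ (Or.inl o1))
    have m2 : β 1 - γ 1 ≠ 0 := sub_ne_zero.2 (hbc _ _ (Or.inl o1))
    have m3 : γ 1 - α 1 ≠ 0 := sub_ne_zero.2 (hca _ _ (Or.inl o1))
    have k1 : β 1 - α 1 = -(α 1 - β 1) := by ring
    have k2 : γ 1 - β 1 = -(β 1 - γ 1) := by ring
    have k3 : α 1 - γ 1 = -(γ 1 - α 1) := by ring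
    rw [k1, k2, k3]
    field_simp
  rw [← exp_pi_mul_I, exp_eq_exp_iff_exists_int] at hp
  obtain ⟨m, hm⟩ := hp
  have him : (zz α β 1 1 + zz β γ 1 1 + zz γ α 1 1).im = (1 + 2 * m) * Real.pi := by
    rw [hm]; simp; ring
  have small : |(zz α β 1 1 + zz β γ 1 1 + zz γ α 1 1).im| < 3 * Real.pi := by
    rw [key]
    have rr : ∀ {α β : ℝ → ℂ}, Continuous α → Fan α β → α 0 = β 0 → ∀ {s t : ℝ}, 0 < s → 0 < t →
        ‖β t - β 0‖ = r → (∀ τ, 0 ≤ τ → τ ≤ s → ‖α τ - α 0‖ ≤ r) →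
        |(tang α (β t) 0 s).im| < Real.pi / 2 := by
      intro α β h hf h0 s t hs ht e1 e2
      refine tang_small h hs (v := α 0) rfl (fun τ => hf _ _ (Or.inr ht)) fun τ a b => ?_
      rw [h0, e1, ← h0]
      exact e2 τ a b
    have a1 := rr hα hab (hv.symm.trans h1) s0 t0 tr sle
    have a2 := rr hβ hab.symm (h1.symm.trans hv) t0 s0 sr tle
    have a3 := rr hβ hbc h2 t0 u0 ur tle
    have a4 := rr hγ hbc.symm h2.symm u0 t0 tr ule
    have a5 := rr hγ hca (h2.symm.trans (h1.symm.trans hv)) u0 s0 sr ule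
    have a6 := rr hα hca.symm (hv.symm.trans (h1.trans h2)) s0 u0 ur sle
    simp only [zz, add_im, sub_im]
    rw [abs_lt] at *
    constructor <;> linarith
  rw [him] at small ⊢
  rw [abs_mul, abs_of_pos Real.pi_pos] at small
  have hlt := lt_of_mul_lt_mul_right small Real.pi_pos.le
  rw [abs_lt] at hlt
  have l1 : -2 < m := by have : (-2:ℝ) < m := by linarith [hlt.1]
                         exact_mod_cast this
  have l2 : m < 1 := by have : (m:ℝ) < 1 := by linarith [hlt.2]
                        exact_mod_cast this
  have : m = 0 ∨ m = -1 := by omega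
  rcases this with rfl | rfl
  · left; simp
  · right; push_cast; ring

end

section
open Complex

section TData
variable {W : Type*} {G : SimpleGraph W} (D : Drawing G)

noncomputable def toC (p : ℝ × ℝ) : ℂ := ⟨p.1, p.2⟩

theorem toC_inj {p q : ℝ × ℝ} (h : toC p = toC q) : p = q := by
  have h1 := congrArg Complex.re h
  have h2 := congrArg Complex.im h
  exact Prod.ext h1 h2

theorem toC_cont : Continuous toC := by
  have : toC = fun p : ℝ × ℝ => (p.1 : ℂ) + p.2 * I := by
    funext p; apply Complex.ext <;> simp [toC]
  rw [this]; fun_prop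

noncomputable def clamp01 (t : ℝ) : ℝ := max 0 (min 1 t)
theorem clamp01_mem (t : ℝ) : clamp01 t ∈ Set.Icc (0:ℝ) 1 :=
  ⟨le_max_left _ _, max_le zero_le_one (min_le_left _ _)⟩
theorem clamp01_pos {t : ℝ} (h : 0 < t) : 0 < clamp01 t :=
  lt_max_of_lt_right (lt_min one_pos h)
theorem clamp01_cont : Continuous clamp01 := by unfold clamp01; fun_prop
theorem clamp01_sub (t : ℝ) : clamp01 (1 - t) = 1 - clamp01 t := by
  unfold clamp01
  rcases le_total t 0 with h | h
  · rw [min_eq_left (by linarith), min_eq_right (by linarith), max_eq_left h]; simp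
  · rcases le_total t 1 with h' | h'
    · rw [min_eq_right (by linarith), min_eq_right h', max_eq_right h, max_eq_right (by linarith)]
    · rw [min_eq_right (by linarith), min_eq_left h', max_eq_left (by linarith)]; simp
@[simp] theorem clamp01_zero : clamp01 0 = 0 := by simp [clamp01]
@[simp] theorem clamp01_one : clamp01 1 = 1 := by simp [clamp01]

noncomputable def arcC (a b : W) (t : ℝ) : ℂ := toC (D.arc a b (clamp01 t))

variable {D}
theorem arcC_cont {a b : W} (h : G.Adj a b) : Continuous (arcC D a b) :=
  toC_cont.comp ((D.arc_cont h).comp_continuous clamp01_cont clamp01_mem)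
theorem arcC_zero {a b : W} (h : G.Adj a b) : arcC D a b 0 = toC (D.pos a) := by
  simp [arcC, D.arc_zero h]
theorem arcC_one {a b : W} (h : G.Adj a b) : arcC D a b 1 = toC (D.pos b) := by
  simp [arcC, D.arc_one h]
theorem arcC_ne {a b c : W} (h : G.Adj a b) (h1 : c ≠ a) (h2 : c ≠ b) (t : ℝ) :
    arcC D a b t ≠ toC (D.pos c) := fun e =>
  D.arc_avoid h c h1 h2 ⟨_, clamp01_mem t, toC_inj e⟩
theorem arcC_symm {a b : W} (h : G.Adj a b) (t : ℝ) : arcC D b a t = arcC D a b (1 - t) := by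
  rw [arcC, arcC, D.arc_symm h, clamp01_sub]

theorem pos_mem_ends {e : Sym2 W} {p : ℝ × ℝ} :
    p ∈ D.ends e ↔ ∃ a ∈ e, p = D.pos a := Iff.rfl

theorem crossing_of_common {a b c d : W} (h : G.Adj a b) (h' : G.Adj c d)
    (hac : a ≠ c) (had : a ≠ d) (hbc : b ≠ c) (hbd : b ≠ d) {s t : ℝ}
    (e : arcC D a b s = arcC D c d t) : ∃ p, D.IsCrossing s(a,b) s(c,d) p := by
  have e' := toC_inj e
  refine ⟨D.arc a b (clamp01 s), h, h', ?_, ⟨a, b, rfl, h, _, clamp01_mem s, rfl⟩,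
    ⟨c, d, rfl, h', _, clamp01_mem t, e'.symm⟩, ?_, ?_⟩
  · intro h; rw [Sym2.eq_iff] at h; tauto
  · rintro ⟨x, hx, hp⟩
    rw [Sym2.mem_iff] at hx
    rw [e'] at hp
    rcases hx with rfl | rfl
    · exact D.arc_avoid h' _ hac had ⟨_, clamp01_mem t, hp⟩
    · exact D.arc_avoid h' _ hbc hbd ⟨_, clamp01_mem t, hp⟩
  · rintro ⟨x, hx, hp⟩
    rw [Sym2.mem_iff] at hx
    rcases hx with rfl | rfl
    · exact D.arc_avoid h _ hac.symm hbc.symm ⟨_, clamp01_mem s, hp⟩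
    · exact D.arc_avoid h _ had.symm hbd.symm ⟨_, clamp01_mem s, hp⟩

theorem fan_of_good (hD : D.IsGood) {v a b : W} (h : G.Adj v a) (h' : G.Adj v b) (hab : a ≠ b) :
    Fan (arcC D v a) (arcC D v b) := by
  intro s t hst e
  have e' := toC_inj e
  set p := D.arc v a (clamp01 s) with hp
  by_cases hv : p = D.pos v
  · have h1 : clamp01 s = 0 := hD.arc_inj h (clamp01_mem s) (by simp)
      (by rw [← hp, hv, D.arc_zero h])
    have h2 : clamp01 t = 0 := hD.arc_inj h' (clamp01_mem t) (by simp)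
      (by rw [← e', hv, D.arc_zero h'])
    rcases hst with hs | hs
    · exact absurd h1 (clamp01_pos hs).ne'
    · exact absurd h2 (clamp01_pos hs).ne'
  · refine hD.adj_no_cross s(v,a) s(v,b) ⟨v, by simp, by simp⟩ p ⟨h, h', ?_,
      ⟨v, a, rfl, h, _, clamp01_mem s, rfl⟩, ⟨v, b, rfl, h', _, clamp01_mem t, e'.symm⟩, ?_, ?_⟩
    · intro hh; rw [Sym2.eq_iff] at hh
      rcases hh with ⟨-, rfl⟩ | ⟨rfl, rfl⟩ <;> exact hab rfl
    · rintro ⟨x, hx, hq⟩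
      rw [Sym2.mem_iff] at hx
      rcases hx with rfl | rfl
      · exact hv hq
      · exact D.arc_avoid h' _ h.ne' hab ⟨_, clamp01_mem t, by rw [← e', hq]⟩
    · rintro ⟨x, hx, hq⟩
      rw [Sym2.mem_iff] at hx
      rcases hx with rfl | rfl
      · exact hv hq
      · exact D.arc_avoid h _ h'.ne' hab.symm ⟨_, clamp01_mem s, hq⟩

theorem tdata (hD : D.IsGood) : ∃ T : W → W → W → ℝ,
    (∀ a b c, G.Adj a b → c ≠ a → c ≠ b → T b a c = - T a b c) ∧
    (∀ a b c d, G.Adj a b → G.Adj c d → a ≠ c → a ≠ d → b ≠ c → b ≠ d →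
      ∃ m : ℤ, T a b c + T c d b - T a b d - T c d a = 2 * m ∧
        (m ≠ 0 → ∃ p, D.IsCrossing s(a,b) s(c,d) p)) ∧
    (∀ v a b c, G.Adj v a → G.Adj v b → G.Adj v c → a ≠ b → b ≠ c → a ≠ c →
      (T v a b - T v b a + T v b c - T v c b + T v c a - T v a c = 1 ∨
       T v a b - T v b a + T v b c - T v c b + T v c a - T v a c = -1)) := by
  refine ⟨fun a b c => (tang (arcC D a b) (toC (D.pos c)) 0 1).im / Real.pi, ?_, ?_, ?_⟩
  · intro a b c h h1 h2
    have hc := arcC_cont (D := D) h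
    have hn := arcC_ne (D := D) h h1 h2
    have e : arcC D b a = fun t => arcC D a b (1 - t) := funext (arcC_symm h)
    simp only
    rw [e, tang_comp hc hn (by fun_prop)]
    simp only [sub_zero, sub_self]
    rw [tang_swap hc hn, neg_im, neg_div]
  · intro a b c d h h' hac had hbc hbd
    have hc := arcC_cont (D := D) h
    have hc' := arcC_cont (D := D) h'
    have key : ∀ m : ℤ, tang (arcC D a b) (toC (D.pos c)) 0 1 + tang (arcC D c d) (toC (D.pos b)) 0 1
        - tang (arcC D a b) (toC (D.pos d)) 0 1 - tang (arcC D c d) (toC (D.pos a)) 0 1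
        = m * (2 * Real.pi * I) →
        (tang (arcC D a b) (toC (D.pos c)) 0 1).im / Real.pi +
        (tang (arcC D c d) (toC (D.pos b)) 0 1).im / Real.pi
        - (tang (arcC D a b) (toC (D.pos d)) 0 1).im / Real.pi
        - (tang (arcC D c d) (toC (D.pos a)) 0 1).im / Real.pi = 2 * m := by
      intro m hm
      have := congrArg Complex.im hm
      simp only [add_im, sub_im] at this
      have e : ((m : ℂ) * (2 * Real.pi * I)).im = 2 * m * Real.pi := by simp; ring
      rw [e] at this
      have hpi := Real.pi_ne_zero
      field_simp
      linarith
    by_cases hx : ∃ p, D.IsCrossing s(a,b) s(c,d) p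
    · obtain ⟨m, hm⟩ := square_int (a := 0) (b := 1) (c := 0) (d := 1) hc hc'
        (by rw [arcC_zero h']; exact arcC_ne h hac.symm hbc.symm)
        (by rw [arcC_one h']; exact arcC_ne h had.symm hbd.symm)
        (by rw [arcC_zero h]; exact arcC_ne h' hac had)
        (by rw [arcC_one h]; exact arcC_ne h' hbc hbd)
      rw [arcC_zero h, arcC_zero h', arcC_one h, arcC_one h'] at hm
      exact ⟨m, key m hm, fun _ => hx⟩
    · refine ⟨0, key 0 ?_, fun h => absurd rfl h⟩
      have := square hc hc' (fun s t e => hx (crossing_of_common h h' hac had hbc hbd e)) 0 1 0 1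
      rw [arcC_zero h, arcC_zero h', arcC_one h, arcC_one h'] at this
      rw [this]; simp
  · intro v a b c ha hb hc hab hbc hac
    have n1 : ∀ {x}, G.Adj v x → arcC D v x 1 ≠ arcC D v x 0 := by
      intro x hx e
      rw [arcC_zero hx, arcC_one hx] at e
      exact hx.ne' (D.pos_inj (toC_inj e))
    have := rot_lemma (arcC_cont ha) (arcC_cont hb) (arcC_cont hc) (fan_of_good hD ha hb hab)
      (fan_of_good hD hb hc hbc) (fan_of_good hD hc ha hac.symm)
      (by rw [arcC_zero ha, arcC_zero hb]) (by rw [arcC_zero hb, arcC_zero hc])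
      (n1 ha) (n1 hb) (n1 hc)
    simp only [zz, arcC_one ha, arcC_one hb, arcC_one hc, add_im, sub_im] at this
    have hpi := Real.pi_ne_zero
    rcases this with h | h
    · left; field_simp; linarith
    · right; field_simp; linarith

end TData

end

section Tables
def wBig : ℕ := 3473264734236267360119819082035916976699208236152667051080
def L24 : List ℕ := [0, 1, 3, 7, 8, 10, 11, 15, 24, 26, 30, 31, 32, 33, 37, 39, 48, 52, 53, 55, 56, 60, 62, 63]
def M2 : List (Bool × Bool × Bool × Bool × ℕ) := [
  (true, true, false, false, 30),
  (true, false, true, false, 45),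
  (false, true, true, false, 51),
  (true, false, false, true, 51),
  (false, true, false, true, 45),
  (false, false, true, true, 30),
  (true, false, false, false, 6),
  (false, true, false, false, 24),
  (false, false, true, false, 43),
  (false, false, false, true, 53),
  (true, false, false, false, 5),
  (false, true, false, false, 27),
  (false, false, true, false, 40),
  (false, false, false, true, 54),
  (false, false, false, false, 3),
  (true, false, false, false, 3),
  (false, true, false, false, 29),
  (false, false, true, false, 46),
  (false, false, false, true, 48),
  (false, false, false, false, 5),
  (false, false, false, false, 6),
  (true, false, false, false, 15),
  (false, true, false, false, 17),
  (false, false, true, false, 34),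
  (false, false, false, true, 60),
  (false, false, false, false, 9),
  (false, false, false, false, 10),
  (false, false, false, false, 12),
  (true, false, false, false, 23),
  (false, true, false, false, 9),
  (false, false, true, false, 58),
  (false, false, false, true, 36),
  (false, false, false, false, 17),
  (false, false, false, false, 18),
  (false, false, false, false, 20),
  (false, false, false, false, 24),
  (true, false, false, false, 39),
  (false, true, false, false, 57),
  (false, false, true, false, 10),
  (false, false, false, true, 20),
  (false, false, false, false, 33),
  (false, false, false, false, 34),
  (false, false, false, false, 36),
  (false, false, false, false, 40),
  (false, false, false, false, 48)]

def wt (m : ℕ) : ℕ := (wBig >>> (3 * m)) % 8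
def vv (a b : ℕ) : ℕ := wt (63 ^^^ a ^^^ b)

def code6 (a b c d e f : Bool) : ℕ :=
  a.toNat + 2 * b.toNat + 4 * c.toNat + 8 * d.toNat + 16 * e.toNat + 32 * f.toNat

/-- triangle code of a graph on five vertices -/
def tri6 (y01 y02 y03 y04 y12 y13 y14 y23 y24 y34 : Bool) : ℕ :=
  code6 (y01 ^^ y02 ^^ y12) (y01 ^^ y03 ^^ y13) (y01 ^^ y04 ^^ y14) (y02 ^^ y03 ^^ y23)
    (y02 ^^ y04 ^^ y24) (y03 ^^ y04 ^^ y34)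

theorem wt_le : ∀ y01 y02 y03 y04 y12 y13 y14 y23 y24 y34 : Bool,
    wt (tri6 y01 y02 y03 y04 y12 y13 y14 y23 y24 y34) ≤ y01.toNat + y02.toNat + y03.toNat +
      y04.toNat + y12.toNat + y13.toNat + y14.toNat + y23.toNat + y24.toNat + y34.toNat ∧
    (y01.toNat + y02.toNat + y03.toNat +
      y04.toNat + y12.toNat + y13.toNat + y14.toNat + y23.toNat + y24.toNat + y34.toNat) % 2 =
    wt (tri6 y01 y02 y03 y04 y12 y13 y14 y23 y24 y34) % 2 := by
  decide +kernel

theorem mem_M2 : ∀ y01 y02 y03 y04 y12 y13 y14 y23 y24 y34 : Bool,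
    y01.toNat + y02.toNat + y03.toNat +
      y04.toNat + y12.toNat + y13.toNat + y14.toNat + y23.toNat + y24.toNat + y34.toNat = 2 →
    (y01, y02, y03, y04, tri6 y01 y02 y03 y04 y12 y13 y14 y23 y24 y34) ∈ M2 := by
  decide +kernel

theorem code_xor : ∀ a b c d e f a' b' c' d' e' f' : Bool,
    code6 (!(a ^^ a')) (!(b ^^ b')) (!(c ^^ c')) (!(d ^^ d')) (!(e ^^ e')) (!(f ^^ f')) =
    63 ^^^ code6 a b c d e f ^^^ code6 a' b' c' d' e' f' := by
  decide +kernel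

theorem code_gen : ∀ a b c d e f : Bool,
    (!(a == d && a != b) && !(a == e && a != c) && !(b == f && b != c) && !(d == f && d != e)) = true →
    code6 a b c d e f ∈ L24 := by
  decide +kernel

def chk3 : Bool := L24.all fun a => L24.all fun b => L24.all fun c =>
  Nat.ble 4 (vv a b + vv b c + vv a c)
theorem chk3_true : chk3 = true := by decide +kernel
theorem vv3 {a b c : ℕ} (ha : a ∈ L24) (hb : b ∈ L24) (hc : c ∈ L24) :
    4 ≤ vv a b + vv b c + vv a c := by
  have := chk3_true
  simp only [chk3, List.all_eq_true] at this
  exact Nat.le_of_ble_eq_true (this a ha b hb c hc)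

theorem vv_par : ∀ a ∈ L24, ∀ b ∈ L24, vv a b % 2 = (wt (63 ^^^ a) + wt (63 ^^^ b)) % 2 := by
  decide +kernel
theorem vv_self : ∀ a ∈ L24, vv a a = 4 := by decide +kernel
theorem vv_symm (a b : ℕ) : vv a b = vv b a := by
  unfold vv; rw [Nat.xor_assoc, Nat.xor_comm a b, ← Nat.xor_assoc]

def chk5 : Bool := L24.all fun a => L24.all fun b => Nat.beq a b ||
  (let F := L24.filter (fun x => Nat.beq (vv x a) 1 && Nat.beq (vv x b) 1)
   F.all fun x => F.all fun y => F.all fun z => Nat.beq x y || Nat.beq y z || Nat.beq x z)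
theorem chk5_true : chk5 = true := by decide +kernel
theorem vv5 {a b x y z : ℕ} (ha : a ∈ L24) (hb : b ∈ L24) (hx : x ∈ L24) (hy : y ∈ L24)
    (hz : z ∈ L24) (hab : a ≠ b) (hxy : x ≠ y) (hyz : y ≠ z) (hxz : x ≠ z)
    (h1 : vv x a = 1) (h2 : vv y a = 1) (h3 : vv z a = 1)
    (h4 : vv x b = 1) (h5 : vv y b = 1) (h6 : vv z b = 1) : False := by
  have := chk5_true
  simp only [chk5, List.all_eq_true, Bool.or_eq_true, Nat.beq_eq, List.mem_filter,
    Bool.and_eq_true] at this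
  rcases this a ha b hb with h | h
  · exact hab h
  · have := h x ⟨hx, h1, h4⟩ y ⟨hy, h2, h5⟩ z ⟨hz, h3, h6⟩
    tauto

def nbr (t : ℕ) : List ℕ := L24.filter (fun x => Nat.beq (vv x t) 1)

def isL (m : ℕ) : Bool := Nat.beq ((15109858928189541771 >>> m) % 2) 1
theorem isL_of_mem : ∀ m ∈ L24, isL m = true := by decide +kernel

def bx (b : Bool) (t acc : ℕ) : ℕ := bif b then acc ^^^ t else acc

def optl (a b : ℕ) : List (Bool × Bool × Bool × Bool) :=
  (M2.filter (fun m => Nat.beq m.2.2.2.2 (63 ^^^ a ^^^ b))).map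
    fun m => (m.1, m.2.1, m.2.2.1, m.2.2.2.1)

def go7 : List (ℕ × List (Bool × Bool × Bool × Bool)) → ℕ → ℕ → ℕ → ℕ → Bool
  | [], A, B, C, D => L24.all fun s =>
      !(isL (63 ^^^ s ^^^ A) && isL (63 ^^^ s ^^^ B) && isL (63 ^^^ s ^^^ C) && isL (63 ^^^ s ^^^ D))
  | (t, l) :: ls, A, B, C, D => l.all fun o =>
      go7 ls (bx o.1 t A) (bx o.2.1 t B) (bx o.2.2.1 t C) (bx o.2.2.2 t D)

def chk7at (t : ℕ) : Bool := match nbr t with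
  | [a, b, c, d, e] =>
    go7 [(7, optl a b), (25, optl a c), (42, optl a d), (52, optl a e),
      (1, optl b c), (2, optl b d), (4, optl b e), (8, optl c d), (16, optl c e), (32, optl d e)]
      0 0 0 0
  | _ => false
def chk7 : Bool := L24.all chk7at
set_option maxRecDepth 10000 in
theorem chk7_true : chk7 = true := by decide +kernel

theorem nbr_five {t : ℕ} (ht : t ∈ L24) : ∃ a b c d e, nbr t = [a, b, c, d, e] := by
  have h := chk7_true
  simp only [chk7, List.all_eq_true] at h
  have h := h t ht
  unfold chk7at at h
  split at h
  · next a b c d e he => exact ⟨a, b, c, d, e, he⟩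
  · simp at h

theorem bx_tri : ∀ y01 y02 y03 y04 y12 y13 y14 y23 y24 y34 : Bool,
    bx y34 32 (bx y24 16 (bx y23 8 (bx y14 4 (bx y13 2 (bx y12 1 (bx y04 52 (bx y03 42
      (bx y02 25 (bx y01 7 0))))))))) = tri6 y01 y02 y03 y04 y12 y13 y14 y23 y24 y34 := by
  decide +kernel

theorem vv7core {t : ℕ} (ht : t ∈ L24) {a b c d e : ℕ} (hn : nbr t = [a, b, c, d, e])
    {p01 p02 p03 p04 p12 p13 p14 p23 p24 p34 : Bool × Bool × Bool × Bool}
    (h01 : p01 ∈ optl a b) (h02 : p02 ∈ optl a c) (h03 : p03 ∈ optl a d) (h04 : p04 ∈ optl a e)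
    (h12 : p12 ∈ optl b c) (h13 : p13 ∈ optl b d) (h14 : p14 ∈ optl b e)
    (h23 : p23 ∈ optl c d) (h24 : p24 ∈ optl c e) (h34 : p34 ∈ optl d e)
    {s0 s1 s2 s3 s4 : ℕ} (hs0 : s0 ∈ L24) (hs1 : s1 ∈ L24) (hs2 : s2 ∈ L24) (hs3 : s3 ∈ L24)
    (hs4 : s4 ∈ L24)
    (e1 : tri6 p01.1 p02.1 p03.1 p04.1 p12.1 p13.1 p14.1 p23.1 p24.1 p34.1 = 63 ^^^ s0 ^^^ s1)
    (e2 : tri6 p01.2.1 p02.2.1 p03.2.1 p04.2.1 p12.2.1 p13.2.1 p14.2.1 p23.2.1 p24.2.1 p34.2.1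
      = 63 ^^^ s0 ^^^ s2)
    (e3 : tri6 p01.2.2.1 p02.2.2.1 p03.2.2.1 p04.2.2.1 p12.2.2.1 p13.2.2.1 p14.2.2.1 p23.2.2.1
      p24.2.2.1 p34.2.2.1 = 63 ^^^ s0 ^^^ s3)
    (e4 : tri6 p01.2.2.2 p02.2.2.2 p03.2.2.2 p04.2.2.2 p12.2.2.2 p13.2.2.2 p14.2.2.2 p23.2.2.2
      p24.2.2.2 p34.2.2.2 = 63 ^^^ s0 ^^^ s4) : False := by
  have h := chk7_true
  simp only [chk7, List.all_eq_true] at h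
  have h := h t ht
  unfold chk7at at h
  rw [hn] at h
  simp only [go7, List.all_eq_true] at h
  have h := h _ h01 _ h02 _ h03 _ h04 _ h12 _ h13 _ h14 _ h23 _ h24 _ h34 s0 hs0
  rw [bx_tri, bx_tri, bx_tri, bx_tri, e1, e2, e3, e4] at h
  have k : ∀ s, 63 ^^^ s0 ^^^ (63 ^^^ s0 ^^^ s) = s := by
    intro s
    rw [← Nat.xor_assoc, Nat.xor_self, Nat.zero_xor]
  simp [k, isL_of_mem _ hs1, isL_of_mem _ hs2, isL_of_mem _ hs3, isL_of_mem _ hs4] at h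

theorem mem_optl {a b : ℕ} {y01 y02 y03 y04 y12 y13 y14 y23 y24 y34 : Bool}
    (hs : y01.toNat + y02.toNat + y03.toNat +
      y04.toNat + y12.toNat + y13.toNat + y14.toNat + y23.toNat + y24.toNat + y34.toNat = 2)
    (ht : tri6 y01 y02 y03 y04 y12 y13 y14 y23 y24 y34 = 63 ^^^ a ^^^ b) :
    (y01, y02, y03, y04) ∈ optl a b := by
  have := mem_M2 _ _ _ _ _ _ _ _ _ _ hs
  rw [optl, List.mem_map]
  exact ⟨_, List.mem_filter.2 ⟨this, by rw [Nat.beq_eq]; exact ht⟩, rfl⟩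

end Tables

section Parity
variable {W : Type*} {G : SimpleGraph W}

structure TD (D : Drawing G) (T : W → W → W → ℝ) : Prop where
  anti : ∀ a b c, G.Adj a b → c ≠ a → c ≠ b → T b a c = - T a b c
  int : ∀ a b c d, G.Adj a b → G.Adj c d → a ≠ c → a ≠ d → b ≠ c → b ≠ d →
      ∃ m : ℤ, T a b c + T c d b - T a b d - T c d a = 2 * m ∧
        (m ≠ 0 → ∃ p, D.IsCrossing s(a,b) s(c,d) p)
  odd : ∀ v a b c, G.Adj v a → G.Adj v b → G.Adj v c → a ≠ b → b ≠ c → a ≠ c →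
      (T v a b - T v b a + T v b c - T v c b + T v c a - T v a c = 1 ∨
       T v a b - T v b a + T v b c - T v c b + T v c a - T v a c = -1)

noncomputable def Xi (T : W → W → W → ℝ) (a b c d : W) : ℤ :=
  round ((T a b c + T c d b - T a b d - T c d a) / 2)
noncomputable def oi (T : W → W → W → ℝ) (v a b c : W) : ℤ :=
  round (T v a b - T v b a + T v b c - T v c b + T v c a - T v a c)
noncomputable def par (T : W → W → W → ℝ) (a b c d : W) : Bool := decide (Xi T a b c d % 2 = 1)
noncomputable def sg (T : W → W → W → ℝ) (v a b c : W) : Bool := decide (oi T v a b c = 1)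
noncomputable def yy (T : W → W → W → ℝ) (v w a b : W) : Bool := par T v a w b ^^ par T v b w a

theorem dec_xor (x y : ℤ) : (decide (x % 2 = 1) ^^ decide (y % 2 = 1)) = decide ((x + y) % 2 = 1) := by
  by_cases h1 : x % 2 = 1 <;> by_cases h2 : y % 2 = 1 <;> simp [h1, h2] <;> omega

variable {D : Drawing G} {T : W → W → W → ℝ}

theorem TD.X_spec (h : TD D T) {a b c d : W} (h1 : G.Adj a b) (h2 : G.Adj c d) (h3 : a ≠ c) (h4 : a ≠ d)
    (h5 : b ≠ c) (h6 : b ≠ d) : T a b c + T c d b - T a b d - T c d a = 2 * (Xi T a b c d : ℝ) := by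
  obtain ⟨m, hm, -⟩ := h.int a b c d h1 h2 h3 h4 h5 h6
  rw [Xi, hm]; simp

theorem TD.X_cross (h : TD D T) {a b c d : W} (h1 : G.Adj a b) (h2 : G.Adj c d) (h3 : a ≠ c) (h4 : a ≠ d)
    (h5 : b ≠ c) (h6 : b ≠ d) (hp : par T a b c d = true) : ∃ p, D.IsCrossing s(a,b) s(c,d) p := by
  obtain ⟨m, hm, hc⟩ := h.int a b c d h1 h2 h3 h4 h5 h6
  apply hc
  rintro rfl
  rw [par, Xi, hm] at hp
  simp at hp

theorem TD.o_spec (h : TD D T) {v a b c : W} (h1 : G.Adj v a) (h2 : G.Adj v b) (h3 : G.Adj v c) (h4 : a ≠ b)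
    (h5 : b ≠ c) (h6 : a ≠ c) :
    T v a b - T v b a + T v b c - T v c b + T v c a - T v a c = (oi T v a b c : ℝ) ∧
    (oi T v a b c = 1 ∨ oi T v a b c = -1) := by
  rw [oi]
  rcases h.odd v a b c h1 h2 h3 h4 h5 h6 with e | e
  · rw [e]; simp
  · rw [e]
    have : round (-1 : ℝ) = -1 := by
      have := round_intCast (α := ℝ) (-1)
      simpa using this
    rw [this]; simp

theorem TD.par_swap (h : TD D T) {a b c d : W} (h1 : G.Adj a b) (h2 : G.Adj c d) (h3 : a ≠ c) (h4 : a ≠ d)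
    (h5 : b ≠ c) (h6 : b ≠ d) : par T c d a b = par T a b c d := by
  have e1 := h.X_spec h1 h2 h3 h4 h5 h6
  have e2 := h.X_spec h2 h1 h3.symm h5.symm h4.symm h6.symm
  have : Xi T c d a b = - Xi T a b c d := by
    have : (Xi T c d a b : ℝ) = - Xi T a b c d := by linarith
    exact_mod_cast this
  rw [par, par, this, decide_eq_decide]; omega

theorem TD.par_rev (h : TD D T) {a b c d : W} (h1 : G.Adj a b) (h2 : G.Adj c d) (h3 : a ≠ c) (h4 : a ≠ d)
    (h5 : b ≠ c) (h6 : b ≠ d) : par T b a c d = par T a b c d := by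
  have e1 := h.X_spec h1 h2 h3 h4 h5 h6
  have e2 := h.X_spec h1.symm h2 h5 h6 h3 h4
  have e3 := h.anti a b c h1 h3.symm h5.symm
  have e4 := h.anti a b d h1 h4.symm h6.symm
  have : Xi T b a c d = - Xi T a b c d := by
    have : (Xi T b a c d : ℝ) = - Xi T a b c d := by linarith
    exact_mod_cast this
  rw [par, par, this, decide_eq_decide]; omega

theorem TD.par_rev' (h : TD D T) {a b c d : W} (h1 : G.Adj a b) (h2 : G.Adj c d) (h3 : a ≠ c) (h4 : a ≠ d)
    (h5 : b ≠ c) (h6 : b ≠ d) : par T a b d c = par T a b c d := by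
  rw [← h.par_swap h1 h2 h3 h4 h5 h6, ← h.par_swap h1 h2.symm h4 h3 h6 h5,
    h.par_rev h2 h1 h3.symm h5.symm h4.symm h6.symm]

theorem yy_swap (v w a b : W) : yy T v w b a = yy T v w a b := by
  rw [yy, yy, Bool.xor_comm]

theorem TD.yy_symm (h : TD D T) {v w a b : W} (h1 : G.Adj v a) (h2 : G.Adj v b) (h3 : G.Adj w a)
    (h4 : G.Adj w b) (hvw : v ≠ w) (hab : a ≠ b) : yy T w v a b = yy T v w a b := by
  rw [yy, yy, h.par_swap h1 h4 hvw h2.ne h3.ne' hab, h.par_swap h2 h3 hvw h1.ne h4.ne' hab.symm,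
    Bool.xor_comm]

theorem TD.yy_dual (h : TD D T) {v w a b : W} (h1 : G.Adj v a) (h2 : G.Adj v b) (h3 : G.Adj w a)
    (h4 : G.Adj w b) (hvw : v ≠ w) (hab : a ≠ b) : yy T a b v w = yy T v w a b := by
  rw [yy, yy]
  congr 1
  · rw [h.par_rev h1 h4.symm h2.ne hvw hab h3.ne', h.par_rev' h1 h4 hvw h2.ne h3.ne' hab]
  · rw [h.par_rev h3 h2.symm h4.ne hvw.symm hab h1.ne', h.par_rev' h3 h2 hvw.symm h4.ne h1.ne' hab,
      h.par_swap h2 h3 hvw h1.ne h4.ne' hab.symm]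

theorem TD.R1 (h : TD D T) {v w a b c : W} (va : G.Adj v a) (vb : G.Adj v b) (vc : G.Adj v c)
    (wa : G.Adj w a) (wb : G.Adj w b) (wc : G.Adj w c) (hvw : v ≠ w) (hab : a ≠ b) (hbc : b ≠ c)
    (hac : a ≠ c) :
    (yy T v w a b ^^ yy T v w a c ^^ yy T v w b c) = !(sg T v a b c ^^ sg T w a b c) := by
  have e1 := h.X_spec va wb hvw vb.ne wa.ne' hab
  have e2 := h.X_spec vb wa hvw va.ne wb.ne' hab.symm
  have e3 := h.X_spec vb wc hvw vc.ne wb.ne' hbc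
  have e4 := h.X_spec vc wb hvw vb.ne wc.ne' hbc.symm
  have e5 := h.X_spec vc wa hvw va.ne wc.ne' hac.symm
  have e6 := h.X_spec va wc hvw vc.ne wa.ne' hac
  obtain ⟨o1, o1'⟩ := h.o_spec va vb vc hab hbc hac
  obtain ⟨o2, o2'⟩ := h.o_spec wa wb wc hab hbc hac
  have key : 2 * (Xi T v a w b - Xi T v b w a + Xi T v b w c - Xi T v c w b + Xi T v c w a
      - Xi T v a w c) = -(oi T v a b c + oi T w a b c) := by
    have : (2 * (Xi T v a w b - Xi T v b w a + Xi T v b w c - Xi T v c w b + Xi T v c w a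
      - Xi T v a w c) : ℝ) = -(oi T v a b c + oi T w a b c) := by linarith
    exact_mod_cast this
  simp only [yy, par, dec_xor, sg]
  rcases o1' with o1' | o1' <;> rcases o2' with o2' | o2' <;> rw [o1', o2'] at key <;>
    simp [o1', o2'] <;> omega

theorem TD.cocycle (h : TD D T) {v a b c d : W} (va : G.Adj v a) (vb : G.Adj v b) (vc : G.Adj v c)
    (vd : G.Adj v d) (hab : a ≠ b) (hac : a ≠ c) (had : a ≠ d) (hbc : b ≠ c) (hbd : b ≠ d)
    (hcd : c ≠ d) : (!(sg T v a b c == sg T v a c d && sg T v a b c != sg T v a b d)) = true := by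
  obtain ⟨o1, o1'⟩ := h.o_spec va vb vc hab hbc hac
  obtain ⟨o2, o2'⟩ := h.o_spec va vc vd hac hcd had
  obtain ⟨o3, o3'⟩ := h.o_spec va vb vd hab hbd had
  obtain ⟨o4, o4'⟩ := h.o_spec vb vc vd hbc hcd hbd
  have key : oi T v a b c - oi T v a b d + oi T v a c d - oi T v b c d = 0 := by
    have : (oi T v a b c - oi T v a b d + oi T v a c d - oi T v b c d : ℝ) = 0 := by linarith
    exact_mod_cast this
  simp only [sg]
  rcases o1' with o1' | o1' <;> rcases o2' with o2' | o2' <;> rcases o3' with o3' | o3' <;>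
    rcases o4' with o4' | o4' <;> rw [o1', o2', o3', o4'] at key <;> simp [o1', o2', o3'] <;> omega

noncomputable def rcode (T : W → W → W → ℝ) (v : W) (f : Fin 5 → W) : ℕ :=
  code6 (sg T v (f 0) (f 1) (f 2)) (sg T v (f 0) (f 1) (f 3)) (sg T v (f 0) (f 1) (f 4))
    (sg T v (f 0) (f 2) (f 3)) (sg T v (f 0) (f 2) (f 4)) (sg T v (f 0) (f 3) (f 4))

/-- triangle code of the pair `v w` over five common neighbours -/
noncomputable def ycode (T : W → W → W → ℝ) (v w : W) (f : Fin 5 → W) : ℕ :=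
  tri6 (yy T v w (f 0) (f 1)) (yy T v w (f 0) (f 2)) (yy T v w (f 0) (f 3)) (yy T v w (f 0) (f 4))
    (yy T v w (f 1) (f 2)) (yy T v w (f 1) (f 3)) (yy T v w (f 1) (f 4))
    (yy T v w (f 2) (f 3)) (yy T v w (f 2) (f 4)) (yy T v w (f 3) (f 4))

theorem TD.rcode_mem (h : TD D T) {v : W} {f : Fin 5 → W} (hf : Function.Injective f)
    (hv : ∀ k, G.Adj v (f k)) : rcode T v f ∈ L24 := by
  apply code_gen
  have q : ∀ i j : Fin 5, i ≠ j → f i ≠ f j := fun i j hij => hf.ne hij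
  rw [h.cocycle (hv 0) (hv 1) (hv 2) (hv 3) (q _ _ (by decide)) (q _ _ (by decide))
      (q _ _ (by decide)) (q _ _ (by decide)) (q _ _ (by decide)) (q _ _ (by decide)),
    h.cocycle (hv 0) (hv 1) (hv 2) (hv 4) (q _ _ (by decide)) (q _ _ (by decide))
      (q _ _ (by decide)) (q _ _ (by decide)) (q _ _ (by decide)) (q _ _ (by decide)),
    h.cocycle (hv 0) (hv 1) (hv 3) (hv 4) (q _ _ (by decide)) (q _ _ (by decide))
      (q _ _ (by decide)) (q _ _ (by decide)) (q _ _ (by decide)) (q _ _ (by decide)),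
    h.cocycle (hv 0) (hv 2) (hv 3) (hv 4) (q _ _ (by decide)) (q _ _ (by decide))
      (q _ _ (by decide)) (q _ _ (by decide)) (q _ _ (by decide)) (q _ _ (by decide))]
  rfl

theorem TD.ycode_eq (h : TD D T) {v w : W} {f : Fin 5 → W} (hf : Function.Injective f)
    (hv : ∀ k, G.Adj v (f k)) (hw : ∀ k, G.Adj w (f k)) (hvw : v ≠ w) :
    ycode T v w f = 63 ^^^ rcode T v f ^^^ rcode T w f := by
  have q : ∀ i j : Fin 5, i ≠ j → f i ≠ f j := fun i j hij => hf.ne hij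
  have r : ∀ i j k : Fin 5, i ≠ j → j ≠ k → i ≠ k →
      (yy T v w (f i) (f j) ^^ yy T v w (f i) (f k) ^^ yy T v w (f j) (f k)) =
      !(sg T v (f i) (f j) (f k) ^^ sg T w (f i) (f j) (f k)) := fun i j k h1 h2 h3 =>
    h.R1 (hv i) (hv j) (hv k) (hw i) (hw j) (hw k) hvw (q _ _ h1) (q _ _ h2) (q _ _ h3)
  rw [ycode, rcode, rcode, ← code_xor, tri6, r 0 1 2 (by decide) (by decide) (by decide),
    r 0 1 3 (by decide) (by decide) (by decide), r 0 1 4 (by decide) (by decide) (by decide),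
    r 0 2 3 (by decide) (by decide) (by decide), r 0 2 4 (by decide) (by decide) (by decide),
    r 0 3 4 (by decide) (by decide) (by decide)]

/-- two disjoint triangles cross evenly -/
theorem TD.triangles (h : TD D T) {i p q k r s : W} (ip : G.Adj i p) (pq : G.Adj p q) (iq : G.Adj i q)
    (kr : G.Adj k r) (rs : G.Adj r s) (ks : G.Adj k s)
    (n1 : i ≠ k) (n2 : i ≠ r) (n3 : i ≠ s) (n4 : p ≠ k) (n5 : p ≠ r) (n6 : p ≠ s)
    (n7 : q ≠ k) (n8 : q ≠ r) (n9 : q ≠ s) :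
    (par T i p k r ^^ par T i p r s ^^ par T i p k s ^^ par T p q k r ^^ par T p q r s ^^
      par T p q k s ^^ par T i q k r ^^ par T i q r s ^^ par T i q k s) = false := by
  have e1 := h.X_spec ip kr n1 n2 n4 n5
  have e2 := h.X_spec ip rs n2 n3 n5 n6
  have e3 := h.X_spec ip ks n1 n3 n4 n6
  have e4 := h.X_spec pq kr n4 n5 n7 n8
  have e5 := h.X_spec pq rs n5 n6 n8 n9
  have e6 := h.X_spec pq ks n4 n6 n7 n9
  have e7 := h.X_spec iq kr n1 n2 n7 n8
  have e8 := h.X_spec iq rs n2 n3 n8 n9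
  have e9 := h.X_spec iq ks n1 n3 n7 n9
  have key : Xi T i p k r + Xi T i p r s - Xi T i p k s + Xi T p q k r + Xi T p q r s
     - Xi T p q k s - Xi T i q k r - Xi T i q r s + Xi T i q k s = 0 := by
    have : (Xi T i p k r + Xi T i p r s - Xi T i p k s + Xi T p q k r + Xi T p q r s
     - Xi T p q k s - Xi T i q k r - Xi T i q r s + Xi T i q k s : ℝ) = 0 := by linarith
    exact_mod_cast this
  simp only [par, dec_xor, decide_eq_false_iff_not]
  omega

/-- crossings of a star at `i` with the tripod at `c` -/
noncomputable def Qp (T : W → W → W → ℝ) (i a c b b' b'' : W) : Bool :=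
  par T c b i a ^^ par T c b i b' ^^ par T c b' i a ^^ par T c b' i b ^^ par T c b'' i b ^^
    par T c b'' i b' ^^ par T a b'' i b ^^ par T a b'' i b'

theorem TD.tripod_aux (h : TD D T) {i a c b b' b'' : W} (ia : G.Adj i a) (ic : i ≠ c) (ib : G.Adj i b)
    (ib' : G.Adj i b') (ib'' : i ≠ b'') (cb : G.Adj c b) (cb' : G.Adj c b') (cb'' : G.Adj c b'')
    (ab : a ≠ b) (ab' : a ≠ b') (ab'' : G.Adj a b'') (n1 : b ≠ b') (n2 : b ≠ b'') (n3 : b' ≠ b'')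
    (nac : a ≠ c) :
    2 * ((Xi T c b i a - Xi T c b i b' - Xi T c b' i a + Xi T c b' i b - Xi T c b'' i b
      + Xi T c b'' i b' + Xi T a b'' i b - Xi T a b'' i b' : ℤ) : ℝ) = (oi T i a b b' : ℝ)
      + (-(T c b a - T c b b') + (T c b' a - T c b' b) + (T c b'' b - T c b'' b')
        - (T a b'' b - T a b'' b')) := by
  have e1 := h.X_spec cb ia ic.symm nac.symm ib.ne' ab.symm
  have e2 := h.X_spec cb ib' ic.symm cb'.ne ib.ne' n1
  have e3 := h.X_spec cb' ia ic.symm nac.symm ib'.ne' ab'.symm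
  have e4 := h.X_spec cb' ib ic.symm cb.ne ib'.ne' n1.symm
  have e5 := h.X_spec cb'' ib ic.symm cb.ne ib''.symm n2.symm
  have e6 := h.X_spec cb'' ib' ic.symm cb'.ne ib''.symm n3.symm
  have e7 := h.X_spec ab'' ib ia.ne' ab ib''.symm n2.symm
  have e8 := h.X_spec ab'' ib' ia.ne' ab' ib''.symm n3.symm
  obtain ⟨o1, -⟩ := h.o_spec ia ib ib' ab n1 ab'
  push_cast
  linarith

theorem TD.tripod (h : TD D T) {i k a c b b' b'' : W} (hik : G.Adj i a ∧ G.Adj i b ∧ G.Adj i b' ∧ i ≠ c ∧ i ≠ b'')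
    (hk : G.Adj k a ∧ G.Adj k b ∧ G.Adj k b' ∧ k ≠ c ∧ k ≠ b'')
    (cb : G.Adj c b) (cb' : G.Adj c b') (cb'' : G.Adj c b'')
    (ab : a ≠ b) (ab' : a ≠ b') (ab'' : G.Adj a b'') (n1 : b ≠ b') (n2 : b ≠ b'') (n3 : b' ≠ b'')
    (nac : a ≠ c) :
    (Qp T i a c b b' b'' ^^ Qp T k a c b b' b'') = (sg T i a b b' ^^ sg T k a b b') := by
  obtain ⟨i1, i2, i3, i4, i5⟩ := hik
  obtain ⟨k1, k2, k3, k4, k5⟩ := hk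
  have e1 := h.tripod_aux i1 i4 i2 i3 i5 cb cb' cb'' ab ab' ab'' n1 n2 n3 nac
  have e2 := h.tripod_aux k1 k4 k2 k3 k5 cb cb' cb'' ab ab' ab'' n1 n2 n3 nac
  obtain ⟨-, o1⟩ := h.o_spec i1 i2 i3 ab n1 ab'
  obtain ⟨-, o2⟩ := h.o_spec k1 k2 k3 ab n1 ab'
  have key := (fun {x y z w t} p q => by linarith :
    ∀ {x y z w t : ℝ}, 2 * x = z + t → 2 * y = w + t → 2 * x - 2 * y = z - w) e1 e2
  have cst : ∀ {x y z w : ℤ}, 2 * (x : ℝ) - 2 * y = z - w → 2 * x - 2 * y = z - w := by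
    intro x y z w hh; exact_mod_cast hh
  replace key := cst key
  simp only [Qp, par, dec_xor, sg]
  rcases o1 with o1 | o1 <;> rcases o2 with o2 | o2 <;> rw [o1, o2] at key ⊢ <;>
    simp <;> omega
end Parity

section Kleitman
variable {ι : Type*} [DecidableEq ι]

/-- twice the total weight on pairs of `S` -/
def tot (c : ι → ι → ℕ) (S : Finset ι) : ℕ := ∑ i ∈ S, ∑ j ∈ S, c i j

theorem tot_erase (c : ι → ι → ℕ) (hs : ∀ i j, c i j = c j i) (h0 : ∀ i, c i i = 0)
    (S : Finset ι) {i : ι} (hi : i ∈ S) :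
    tot c S = tot c (S.erase i) + 2 * ∑ j ∈ S, c i j := by
  unfold tot
  rw [← Finset.add_sum_erase S _ hi]
  have : ∀ k ∈ S.erase i, ∑ j ∈ S, c k j = c i k + ∑ j ∈ S.erase i, c k j := by
    intro k _
    rw [← Finset.add_sum_erase S _ hi, hs k i]
  rw [Finset.sum_congr rfl this, Finset.sum_add_distrib]
  have h2 : ∑ k ∈ S.erase i, c i k = ∑ j ∈ S, c i j := by
    rw [← Finset.add_sum_erase S (fun j => c i j) hi, h0]; simp
  rw [h2]; ring

/-- `Z 5 n` -/
def z5 (n : ℕ) : ℕ := 4 * (n / 2) * ((n - 1) / 2)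

theorem tot_even (c : ι → ι → ℕ) (hs : ∀ i j, c i j = c j i) (h0 : ∀ i, c i i = 0) (σ : ι → ℕ)
    (h2 : ∀ i j, i ≠ j → c i j % 2 = (σ i + σ j) % 2) (S : Finset ι) :
    ∃ k, tot c S = 2 * k ∧ (k + (S.card + 1) * ∑ i ∈ S, σ i) % 2 = 0 := by
  induction S using Finset.induction_on with
  | empty => exact ⟨0, by simp [tot], by simp⟩
  | insert a S ha ih =>
    obtain ⟨k, hk, hp⟩ := ih
    have := tot_erase c hs h0 (insert a S) (Finset.mem_insert_self a S)
    rw [Finset.erase_insert ha, hk, Finset.sum_insert ha, h0, zero_add] at this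
    refine ⟨k + ∑ j ∈ S, c a j, by rw [this]; ring, ?_⟩
    have h3 : (∑ j ∈ S, c a j) % 2 = (S.card * σ a + ∑ j ∈ S, σ j) % 2 := by
      rw [Finset.sum_nat_mod, Finset.sum_congr rfl (fun j hj => h2 a j (by rintro rfl; exact ha hj)),
        ← Finset.sum_nat_mod, Finset.sum_add_distrib]
      simp
    rw [Finset.card_insert_of_notMem ha, Finset.sum_insert ha]
    have e : k + ∑ j ∈ S, c a j + (S.card + 1 + 1) * (σ a + ∑ j ∈ S, σ j)
      = (k + (S.card + 1) * ∑ j ∈ S, σ j) + (∑ j ∈ S, c a j + (S.card * σ a + ∑ j ∈ S, σ j))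
        + 2 * σ a := by ring
    rw [e]; omega

theorem kleitman (c : ι → ι → ℕ) (hs : ∀ i j, c i j = c j i) (h0 : ∀ i, c i i = 0)
    (h1 : ∀ i j k, i ≠ j → j ≠ k → i ≠ k → 4 ≤ c i j + c j k + c i k)
    (σ : ι → ℕ) (h2 : ∀ i j, i ≠ j → c i j % 2 = (σ i + σ j) % 2)
    (bad5 : ∀ t t' i j k, t ≠ t' → i ≠ j → j ≠ k → i ≠ k → i ≠ t → j ≠ t → k ≠ t → i ≠ t' →
      j ≠ t' → k ≠ t' → c t t' = 2 →
      c i t = 1 → c j t = 1 → c k t = 1 → c i t' = 1 → c j t' = 1 → c k t' = 1 →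
      c i j = 2 → c j k = 2 → c i k = 2 → False)
    (bad7 : ∀ t (I : Finset ι), I.card = 5 → t ∉ I → (∀ i ∈ I, c i t = 1) →
      (∀ i ∈ I, ∀ j ∈ I, i ≠ j → c i j = 2) → False) :
    ∀ (n : ℕ) (S : Finset ι), S.card = n → 2 * z5 n ≤ tot c S := by
  intro n
  induction n using Nat.strong_induction_on with
  | _ n ih =>
  intro S hS
  have hdeg : ∀ i ∈ S, 2 * z5 (n-1) + 2 * ∑ j ∈ S, c i j ≤ tot c S := by
    intro i hi
    have hpos : 0 < n := by rw [← hS]; exact Finset.card_pos.2 ⟨i, hi⟩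
    have := ih (n-1) (by omega) (S.erase i) (by rw [Finset.card_erase_of_mem hi, hS])
    rw [tot_erase c hs h0 S hi]; omega
  have hsum : n * (2 * z5 (n-1)) + 2 * tot c S ≤ n * tot c S := by
    have := Finset.sum_le_sum hdeg
    rw [Finset.sum_add_distrib, Finset.sum_const, Finset.sum_const, ← Finset.mul_sum, hS] at this
    simpa [tot] using this
  rcases Nat.lt_or_ge n 3 with hn | hn
  · have : z5 n = 0 := by interval_cases n <;> rfl
    omega
  rcases Nat.even_or_odd' n with ⟨m, hm | hm⟩
  · -- even
    have e1 : z5 (n-1) = 4 * ((m-1) * (m-1)) := by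
      unfold z5
      rw [show (n-1)/2 = m-1 by omega, show (n-1-1)/2 = m-1 by omega]; ring
    have e2 : z5 n = 4 * (m * (m-1)) := by
      unfold z5
      rw [show n/2 = m by omega, show (n-1)/2 = m-1 by omega]; ring
    obtain ⟨k, rfl⟩ : ∃ k, m = k + 2 := ⟨m - 2, by omega⟩
    rw [e1] at hsum
    rw [e2]
    subst hm
    simp only [show k + 2 - 1 = k + 1 by omega] at *
    nlinarith
  -- odd
  rcases Nat.lt_or_ge n 5 with hn5 | hn5
  · have h3 : n = 3 := by omega
    subst h3
    obtain ⟨x, y, z, hxy, hxz, hyz, rfl⟩ := Finset.card_eq_three.1 hS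
    have e : tot c {x, y, z} = 2 * (c x y + c y z + c x z) := by
      unfold tot
      simp [Finset.sum_insert, hxy, hxz, hyz, h0, hs y x, hs z x, hs z y]; ring
    have := h1 x y z hxy hyz hxz
    rw [e]; simp [z5]; omega
  by_contra hcon
  obtain ⟨k, rfl⟩ : ∃ k, m = k + 2 := ⟨m - 2, by omega⟩
  have e0 : z5 n = 4 * ((k+2) * (k+2)) := by
    unfold z5
    rw [show n/2 = k+2 by omega, show (n-1)/2 = k+2 by omega]; ring
  have e1 : z5 (n-1) = 4 * ((k+2) * (k+1)) := by
    unfold z5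
    rw [show (n-1)/2 = k+2 by omega, show (n-1-1)/2 = k+1 by omega]; ring
  have e2 : z5 (n-2) = 4 * ((k+1) * (k+1)) := by
    unfold z5
    rw [show (n-2)/2 = k+1 by omega, show (n-2-1)/2 = k+1 by omega]; ring
  obtain ⟨q, hq, hpar⟩ := tot_even c hs h0 σ h2 S
  have hq2 : q % 2 = 0 := by
    have e : (S.card + 1) = 2 * (k + 3) := by omega
    rw [e, mul_assoc] at hpar; omega
  rw [e0, not_le] at hcon
  rw [e1, hq] at hsum
  have hqv : q + 2 = 4 * ((k+2) * (k+2)) := by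
    have l1 : q < 4 * ((k+2)*(k+2)) := by omega
    by_contra hne
    have l2 : q + 4 ≤ 4 * ((k+2)*(k+2)) := by omega
    subst hm
    nlinarith
  set deg : ι → ℕ := fun i => ∑ j ∈ S, c i j with hdegdef
  have hdle : ∀ i ∈ S, deg i + 4 ≤ 2 * n := by
    intro i hi
    have := hdeg i hi
    rw [hq, e1] at this
    simp only [hdegdef]
    nlinarith
  obtain ⟨d, hd⟩ : ∃ d : ι → ℕ, ∀ i ∈ S, d i + deg i + 4 = 2 * n :=
    ⟨fun i => 2 * n - 4 - deg i, fun i hi => by have := hdle i hi; simp only; omega⟩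
  have hdsum : ∑ i ∈ S, d i = 2 := by
    have := Finset.sum_congr rfl hd
    rw [Finset.sum_add_distrib, Finset.sum_add_distrib] at this
    simp only [Finset.sum_const, hS, smul_eq_mul] at this
    have e : ∑ i ∈ S, deg i = 2 * q := hq
    rw [e] at this
    subst hm
    nlinarith
  have hc2 : ∀ i ∈ S, ∀ j ∈ S, i ≠ j → 2 ≤ c i j + d i + d j := by
    intro i hi j hj hij
    have hj' : j ∈ S.erase i := Finset.mem_erase.2 ⟨hij.symm, hj⟩
    have a1 := tot_erase c hs h0 S hi
    have a2 := tot_erase c hs h0 (S.erase i) hj'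
    have a3 := ih (n-2) (by omega) ((S.erase i).erase j)
      (by rw [Finset.card_erase_of_mem hj', Finset.card_erase_of_mem hi, hS]; omega)
    have a4 : deg j = c j i + ∑ l ∈ S.erase i, c j l := (Finset.add_sum_erase S _ hi).symm
    rw [hs j i] at a4
    have b1 := hd i hi
    have b2 := hd j hj
    rw [e2] at a3
    have a5 : ∑ j ∈ S, c i j = deg i := rfl
    rw [a5, hq] at a1
    subst hm
    nlinarith
  have htyp : ∀ i ∈ S, d i = 0 → ∀ j ∈ S, j ≠ i → c i j + d j = 2 := by
    intro i hi hdi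
    have hle : ∀ j ∈ S.erase i, 2 ≤ c i j + d j := by
      intro j hj
      have := hc2 i hi j (Finset.mem_of_mem_erase hj) (Finset.ne_of_mem_erase hj).symm
      omega
    have hs1 : ∑ j ∈ S.erase i, (c i j + d j) = ∑ j ∈ S.erase i, 2 := by
      rw [Finset.sum_add_distrib]
      have f1 := Finset.add_sum_erase S (fun j => c i j) hi
      have f2 := Finset.add_sum_erase S d hi
      simp only [h0] at f1
      have b1 := hd i hi
      have a5 : ∑ j ∈ S, c i j = deg i := rfl
      rw [Finset.sum_const, Finset.card_erase_of_mem hi, hS, smul_eq_mul]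
      omega
    have := (Finset.sum_eq_sum_iff_of_le hle).1 hs1.symm
    intro j hj hji
    exact (this j (Finset.mem_erase.2 ⟨hji, hj⟩)).symm
  -- find t with d t > 0
  obtain ⟨t, ht, hdt⟩ : ∃ t ∈ S, d t ≠ 0 := by
    by_contra hh
    push Not at hh
    rw [Finset.sum_eq_zero hh] at hdsum
    omega
  have hrest := Finset.add_sum_erase S d ht
  rw [hdsum] at hrest
  have hd2 : d t = 1 ∨ d t = 2 := by omega
  rcases hd2 with hd1 | hd2
  swap
  · have hz : ∀ j ∈ S.erase t, d j = 0 := by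
      apply Finset.sum_eq_zero_iff.1; omega
    have : deg t = 0 := by
      apply Finset.sum_eq_zero
      intro j hj
      by_cases hjt : j = t
      · rw [hjt, h0]
      · have := htyp j hj (hz j (Finset.mem_erase.2 ⟨hjt, hj⟩)) t ht (Ne.symm hjt)
        rw [hs]; omega
    have := hd t ht
    omega
  obtain ⟨t', ht', hdt'⟩ : ∃ t' ∈ S.erase t, d t' ≠ 0 := by
    by_contra hh
    push Not at hh
    rw [Finset.sum_eq_zero hh] at hrest
    omega
  have hrest' := Finset.add_sum_erase (S.erase t) d ht'
  have hdt1 : d t' = 1 := by omega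
  have hz : ∀ j ∈ (S.erase t).erase t', d j = 0 := by
    apply Finset.sum_eq_zero_iff.1; omega
  have htt : t' ≠ t := Finset.ne_of_mem_erase ht'
  have htS : t' ∈ S := Finset.mem_of_mem_erase ht'
  set R := (S.erase t).erase t' with hR
  have hRS : ∀ i ∈ R, i ∈ S ∧ i ≠ t ∧ i ≠ t' := by
    intro i hi
    simp only [hR, Finset.mem_erase] at hi
    tauto
  have hRc : R.card = n - 2 := by
    rw [hR, Finset.card_erase_of_mem ht', Finset.card_erase_of_mem ht, hS]; omega
  have c1 : ∀ i ∈ R, c i t = 1 := fun i hi => by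
    have := htyp i (hRS i hi).1 (hz i hi) t ht (hRS i hi).2.1.symm
    omega
  have c1' : ∀ i ∈ R, c i t' = 1 := fun i hi => by
    have := htyp i (hRS i hi).1 (hz i hi) t' htS (hRS i hi).2.2.symm
    omega
  have c2 : ∀ i ∈ R, ∀ j ∈ R, i ≠ j → c i j = 2 := fun i hi j hj hij => by
    have := htyp i (hRS i hi).1 (hz i hi) j (hRS j hj).1 hij.symm
    have := hz j hj
    omega
  rcases Nat.lt_or_ge n 7 with hn7 | hn7
  · have hn' : n = 5 := by omega
    have hR3 : R.card = 3 := by omega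
    obtain ⟨x, y, z, hxy, hxz, hyz, hxyz⟩ := Finset.card_eq_three.1 hR3
    have hx : x ∈ R := by rw [hxyz]; simp
    have hy : y ∈ R := by rw [hxyz]; simp
    have hzz : z ∈ R := by rw [hxyz]; simp
    have hdt5 := hd t ht
    have f1 : deg t = c t t + (c t t' + ∑ j ∈ R, c t j) := by
      rw [hR, Finset.add_sum_erase (S.erase t) (fun j => c t j) ht',
        Finset.add_sum_erase S (fun j => c t j) ht]
    have f2 : ∑ j ∈ R, c t j = 3 := by
      rw [Finset.sum_congr rfl (fun j hj => by rw [hs t j, c1 j hj] : ∀ j ∈ R, c t j = 1)]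
      simp [hR3]
    rw [h0, f2] at f1
    exact bad5 t t' x y z htt.symm hxy hyz hxz (hRS x hx).2.1 (hRS y hy).2.1 (hRS z hzz).2.1
      (hRS x hx).2.2 (hRS y hy).2.2 (hRS z hzz).2.2 (by omega)
      (c1 x hx) (c1 y hy) (c1 z hzz) (c1' x hx) (c1' y hy) (c1' z hzz)
      (c2 x hx y hy hxy) (c2 y hy z hzz hyz) (c2 x hx z hzz hxz)
  · obtain ⟨I, hIR, hI5⟩ := Finset.exists_subset_card_eq (show 5 ≤ R.card by omega)
    exact bad7 t I hI5 (fun h => (hRS t (hIR h)).2.1 rfl) (fun i hi => c1 i (hIR hi))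
      (fun i hi j hj => c2 i (hIR hi) j (hIR hj))

end Kleitman

section Lower

theorem z5_step (n : ℕ) (hn : 0 < n) : z5 n ≤ z5 (n-1) + 2 * n - 2 := by
  obtain ⟨m, rfl | rfl⟩ := Nat.even_or_odd' n
  · obtain ⟨k, rfl⟩ : ∃ k, m = k + 1 := ⟨m - 1, by omega⟩
    have e1 : z5 (2 * (k+1)) = 4 * (k+1) * k := by
      unfold z5
      rw [show 2 * (k+1) / 2 = k+1 by omega, show (2 * (k+1) - 1) / 2 = k by omega]
    have e2 : z5 (2 * (k+1) - 1) = 4 * k * k := by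
      unfold z5
      rw [show (2 * (k+1) - 1) / 2 = k by omega, show (2 * (k+1) - 1 - 1) / 2 = k by omega]
    rw [e1, e2]
    have : 4 * (k+1) * k = 4 * k * k + 4 * k := by ring
    omega
  · have e1 : z5 (2 * m + 1) = 4 * m * m := by
      unfold z5
      rw [show (2 * m + 1) / 2 = m by omega, show (2 * m + 1 - 1) / 2 = m by omega]
    have e2 : z5 (2 * m + 1 - 1) + 4 * m = 4 * m * m := by
      unfold z5
      rcases m with _ | m
      · rfl
      rw [show (2 * (m + 1) + 1 - 1) / 2 = m + 1 by omega,
        show (2 * (m + 1) + 1 - 1 - 1) / 2 = m by omega]; ring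
    omega

theorem final_bound {n : ℕ} (hn : 0 < n) (c : Fin n → Fin n → ℕ) (u : Fin n → ℕ) (base : ℕ)
    (hs : ∀ i j, c i j = c j i) (h0 : ∀ i, c i i = 0)
    (hK : ∀ S : Finset (Fin n), 2 * z5 S.card ≤ tot c S)
    (hG : ∀ i, u i = 0 → 1 ≤ base ∧ ∀ k, k ≠ i → 4 ≤ c i k + 2 * u k) :
    2 * (z5 n + n) ≤ tot c Finset.univ + 2 * ∑ i, u i + 2 * base := by
  have hA := hK Finset.univ
  rw [Finset.card_univ, Fintype.card_fin] at hA
  by_cases hall : ∀ i, 1 ≤ u i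
  · have := Finset.sum_le_sum (fun i (_ : i ∈ Finset.univ) => hall i)
    simp at this
    omega
  push Not at hall
  obtain ⟨i, hi⟩ := hall
  have hi0 : u i = 0 := by omega
  obtain ⟨hb, hk⟩ := hG i hi0
  by_cases hU : n - 1 ≤ ∑ i, u i
  · omega
  have hE := hK (Finset.univ.erase i)
  rw [Finset.card_erase_of_mem (Finset.mem_univ i), Finset.card_univ, Fintype.card_fin] at hE
  have ht := tot_erase c hs h0 Finset.univ (Finset.mem_univ i)
  have hsum : 4 * (n - 1) ≤ ∑ j, c i j + 2 * ∑ j, u j := by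
    rw [← Finset.add_sum_erase Finset.univ (fun j => c i j) (Finset.mem_univ i),
      ← Finset.add_sum_erase Finset.univ u (Finset.mem_univ i), h0, hi0, zero_add, zero_add,
      Finset.mul_sum, ← Finset.sum_add_distrib]
    have := Finset.sum_le_sum (s := Finset.univ.erase i) (f := fun _ => 4)
      (g := fun k => c i k + 2 * u k) (fun k hk' => hk k (Finset.ne_of_mem_erase hk'))
    simpa [Finset.card_erase_of_mem, mul_comm] using this
  have := z5_step n hn
  omega

theorem sum_lt_double {n : ℕ} (c : Fin n → Fin n → ℕ)
    (hs : ∀ i j, c i j = c j i) (h0 : ∀ i, c i i = 0) :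
    tot c Finset.univ = 2 * ∑ i, ∑ j, (if i < j then c i j else 0) := by
  have : ∀ i j, c i j = (if i < j then c i j else 0) + (if j < i then c j i else 0) := by
    intro i j
    rcases lt_trichotomy i j with h | h | h
    · simp [h, h.le]
    · simp [h, h0]
    · simp [h, h.le, hs i j]
  unfold tot
  rw [two_mul]
  conv_lhs => enter [2, i, 2, j]; rw [this]
  simp only [Finset.sum_add_distrib]
  congr 1
  rw [Finset.sum_comm]

def P10 : Fin 10 → Fin 5 × Fin 5 :=
  ![(0,1), (0,2), (0,3), (0,4), (1,2), (1,3), (1,4), (2,3), (2,4), (3,4)]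
def P20 : Fin 20 → Fin 5 × Fin 5 :=
  ![(0,1), (0,2), (0,3), (0,4), (1,2), (1,3), (1,4), (2,3), (2,4), (3,4),
    (1,0), (2,0), (3,0), (4,0), (2,1), (3,1), (4,1), (3,2), (4,2), (4,3)]
def B18 : Fin 18 → Fin 5 × Fin 5 × Fin 5 :=
  ![(0,2,1), (0,2,3), (0,2,4), (0,3,1), (0,3,2), (0,3,4), (0,4,1), (0,4,2), (0,4,3),
    (1,2,0), (1,2,3), (1,2,4), (1,3,0), (1,3,2), (1,3,4), (1,4,0), (1,4,2), (1,4,3)]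
def C6 : Fin 6 → Fin 5 × Fin 5 := ![(2,3), (2,4), (3,2), (3,4), (4,2), (4,3)]

theorem P20_inj : Function.Injective P20 := by decide
theorem B18_inj : Function.Injective B18 := by decide
theorem C6_inj : Function.Injective C6 := by decide
theorem P20_ne : ∀ k, (P20 k).1 ≠ (P20 k).2 := by decide
theorem P10_ne : ∀ k, (P10 k).1 ≠ (P10 k).2 := by decide
theorem B18_lt : ∀ k, (B18 k).1 < 2 ∧ 2 ≤ (B18 k).2.1 ∧ (B18 k).2.2 ≠ (B18 k).1 ∧
  (B18 k).2.2 ≠ (B18 k).2.1 := by decide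
theorem C6_lt : ∀ k, 2 ≤ (C6 k).1 ∧ 2 ≤ (C6 k).2 ∧ (C6 k).1 ≠ (C6 k).2 := by decide

variable {W : Type*} {G : SimpleGraph W}

theorem IsCrossing.symm' {D : Drawing G} {e f : Sym2 W} {p : ℝ × ℝ} (h : D.IsCrossing e f p) :
    D.IsCrossing f e p := by
  obtain ⟨h1, h2, h3, h4, h5, h6, h7⟩ := h
  exact ⟨h2, h1, h3.symm, h5, h4, h7, h6⟩

/-- the set of crossing pairs of edges -/
def crPairs (D : Drawing G) : Set (Sym2 (Sym2 W)) := {q | ∃ e f p, q = s(e,f) ∧ D.IsCrossing e f p}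

theorem crNum_eq {D : Drawing G} (hD : D.IsGood) : D.crNum = (crPairs D).ncard := by
  unfold Drawing.crNum Drawing.crBetween
  rw [Nat.card_coe_set_eq]
  have himg : crPairs D = Prod.snd '' D.crossings G.edgeSet G.edgeSet := by
    ext q
    constructor
    · rintro ⟨e, f, p, rfl, h⟩
      exact ⟨(p, s(e,f)), ⟨e, f, rfl, h.1, h.2.1, h⟩, rfl⟩
    · rintro ⟨⟨p, q⟩, ⟨e, f, he, -, -, h⟩, rfl⟩
      exact ⟨e, f, p, he, h⟩
  rw [himg, Set.ncard_image_of_injOn]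
  rintro ⟨p, q⟩ ⟨e, f, he, -, -, h⟩ ⟨p', q'⟩ ⟨e', f', he', -, -, h'⟩ hq
  simp only at he he' hq h h'
  subst hq
  rw [he, Sym2.eq_iff] at he'
  have : D.IsCrossing e f p' := by
    rcases he' with ⟨rfl, rfl⟩ | ⟨rfl, rfl⟩
    · exact h'
    · exact IsCrossing.symm' h'
  rw [hD.cross_once e f h this]

structure Emb (G : SimpleGraph W) (n : ℕ) where
  hub : Fin n → W
  leaf : Fin 5 → W
  hub_inj : Function.Injective hub
  leaf_inj : Function.Injective leaf
  hl : ∀ i a, G.Adj (hub i) (leaf a)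
  ll : ∀ p q, p < 2 → 2 ≤ q → G.Adj (leaf p) (leaf q)

variable {n : ℕ} (E : Emb G n) {D : Drawing G} {T : W → W → W → ℝ}

def evPair : (Fin n × Fin n × Fin 20) ⊕ ((Fin n × Fin 18) ⊕ Fin 6) → Sym2 (Sym2 W)
  | .inl (i, j, k) => s(s(E.hub i, E.leaf (P20 k).1), s(E.hub j, E.leaf (P20 k).2))
  | .inr (.inl (i, k)) => s(s(E.leaf (B18 k).1, E.leaf (B18 k).2.1), s(E.hub i, E.leaf (B18 k).2.2))
  | .inr (.inr k) => s(s(E.leaf 0, E.leaf (C6 k).1), s(E.leaf 1, E.leaf (C6 k).2))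

noncomputable def evVal (T : W → W → W → ℝ) :
    (Fin n × Fin n × Fin 20) ⊕ ((Fin n × Fin 18) ⊕ Fin 6) → Bool
  | .inl (i, j, k) => decide (i < j) && par T (E.hub i) (E.leaf (P20 k).1) (E.hub j) (E.leaf (P20 k).2)
  | .inr (.inl (i, k)) => par T (E.leaf (B18 k).1) (E.leaf (B18 k).2.1) (E.hub i) (E.leaf (B18 k).2.2)
  | .inr (.inr k) => par T (E.leaf 0) (E.leaf (C6 k).1) (E.leaf 1) (E.leaf (C6 k).2)

theorem ev_cross (h : TD D T) (x) (hx : evVal E T x = true) : evPair E x ∈ crPairs D := by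
  have hn : ∀ i a, E.hub i ≠ E.leaf a := fun i a => (E.hl i a).ne
  rcases x with ⟨i, j, k⟩ | ⟨i, k⟩ | k
  · simp only [evVal, Bool.and_eq_true, decide_eq_true_eq] at hx
    obtain ⟨p, hp⟩ := h.X_cross (E.hl _ _) (E.hl _ _) (E.hub_inj.ne hx.1.ne) (hn _ _) (hn _ _).symm
      (E.leaf_inj.ne (P20_ne k)) hx.2
    exact ⟨_, _, p, rfl, hp⟩
  · simp only [evVal] at hx
    obtain ⟨h1, h2, h3, h4⟩ := B18_lt k
    obtain ⟨p, hp⟩ := h.X_cross (E.ll _ _ h1 h2) (E.hl _ _) (hn _ _).symm (E.leaf_inj.ne h3.symm)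
      (hn _ _).symm (E.leaf_inj.ne h4.symm) hx
    exact ⟨_, _, p, rfl, hp⟩
  · simp only [evVal] at hx
    obtain ⟨h1, h2, h3⟩ := C6_lt k
    obtain ⟨p, hp⟩ := h.X_cross (E.ll _ _ (by decide) h1) (E.ll _ _ (by decide) h2)
      (E.leaf_inj.ne (by decide)) (E.leaf_inj.ne (by omega))
      (E.leaf_inj.ne (by omega)) (E.leaf_inj.ne h3) hx
    exact ⟨_, _, p, rfl, hp⟩

theorem ev_inj (T : W → W → W → ℝ) {x y} (hx : evVal E T x = true) (hy : evVal E T y = true)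
    (hxy : evPair E x = evPair E y) : x = y := by
  have hn : ∀ i a, E.hub i ≠ E.leaf a := fun i a => (E.hl i a).ne
  have hn' : ∀ i a, E.leaf a ≠ E.hub i := fun i a => (E.hl i a).ne'
  rcases x with ⟨i, j, k⟩ | ⟨i, k⟩ | k <;> rcases y with ⟨i', j', k'⟩ | ⟨i', k'⟩ | k' <;>
    simp only [evPair, Sym2.eq_iff, E.hub_inj.eq_iff, E.leaf_inj.eq_iff, hn, hn', false_and, and_false,
      or_false, false_or] at hxy
  · simp only [evVal, Bool.and_eq_true, decide_eq_true_eq] at hx hy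
    rcases hxy with ⟨⟨rfl, h1⟩, rfl, h2⟩ | ⟨⟨rfl, h1⟩, rfl, h2⟩
    · rw [P20_inj (Prod.ext h1 h2)]
    · exact absurd hx.1 (not_lt.2 hy.1.le)
  · have a1 := B18_lt k
    have a2 := B18_lt k'
    obtain ⟨h1, rfl, h3⟩ := hxy
    have h1 : (B18 k).1 = (B18 k').1 ∧ (B18 k).2.1 = (B18 k').2.1 := by
      rcases h1 with h1 | h1
      · exact h1
      · omega
    rw [B18_inj (Prod.ext h1.1 (Prod.ext h1.2 h3))]
  · have a1 := C6_lt k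
    have a2 := C6_lt k'
    have : (C6 k).1 = (C6 k').1 ∧ (C6 k).2 = (C6 k').2 := by omega
    rw [C6_inj (Prod.ext this.1 this.2)]

theorem crNum_ge [Finite W] (hD : D.IsGood) (h : TD D T) :
    ∑ x, (evVal E T x).toNat ≤ D.crNum := by
  classical
  rw [crNum_eq hD]
  have e1 : ∑ x, (evVal E T x).toNat = (Finset.univ.filter (fun x => evVal E T x = true)).card := by
    rw [Finset.card_filter]
    apply Finset.sum_congr rfl
    intro x _
    cases evVal E T x <;> rfl
  rw [e1, ← Finset.card_image_of_injOn (f := evPair E), ← Set.ncard_coe_finset]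
  · apply Set.ncard_le_ncard _ (Set.toFinite _)
    intro q hq
    simp only [Finset.coe_image, Set.mem_image, Finset.mem_coe, Finset.mem_filter] at hq
    obtain ⟨x, hx, rfl⟩ := hq
    exact ev_cross E h x hx.2
  · intro x hx y hy hxy
    simp at hx hy
    exact ev_inj E T hx hy hxy

end Lower

section Lower2
variable {W : Type*} {G : SimpleGraph W} {n : ℕ} (E : Emb G n) {D : Drawing G} {T : W → W → W → ℝ}

noncomputable def sum10 (T : W → W → W → ℝ) (v w : W) (f : Fin 5 → W) : ℕ :=
  (yy T v w (f 0) (f 1)).toNat + (yy T v w (f 0) (f 2)).toNat + (yy T v w (f 0) (f 3)).toNat +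
  (yy T v w (f 0) (f 4)).toNat + (yy T v w (f 1) (f 2)).toNat + (yy T v w (f 1) (f 3)).toNat +
  (yy T v w (f 1) (f 4)).toNat + (yy T v w (f 2) (f 3)).toNat + (yy T v w (f 2) (f 4)).toNat +
  (yy T v w (f 3) (f 4)).toNat

theorem sum10_wt (v w : W) (f : Fin 5 → W) : wt (ycode T v w f) ≤ sum10 T v w f ∧
    sum10 T v w f % 2 = wt (ycode T v w f) % 2 := wt_le _ _ _ _ _ _ _ _ _ _

noncomputable def cc (T : W → W → W → ℝ) (i j : Fin n) : ℕ :=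
  if i = j then 0 else sum10 T (E.hub i) (E.hub j) E.leaf

noncomputable def rr (T : W → W → W → ℝ) (i : Fin n) : ℕ := rcode T (E.hub i) E.leaf

theorem rr_mem (h : TD D T) (i : Fin n) : rr E T i ∈ L24 := h.rcode_mem E.leaf_inj (E.hl i)

theorem cc_symm (h : TD D T) (i j : Fin n) : cc E T i j = cc E T j i := by
  unfold cc
  by_cases hij : i = j
  · simp [hij]
  rw [if_neg hij, if_neg (Ne.symm hij)]
  unfold sum10
  have q : ∀ a b : Fin 5, a ≠ b → yy T (E.hub i) (E.hub j) (E.leaf a) (E.leaf b) =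
      yy T (E.hub j) (E.hub i) (E.leaf a) (E.leaf b) := fun a b hab =>
    h.yy_symm (E.hl j a) (E.hl j b) (E.hl i a) (E.hl i b) (E.hub_inj.ne (Ne.symm hij)) (E.leaf_inj.ne hab)
  rw [q 0 1 (by decide), q 0 2 (by decide), q 0 3 (by decide), q 0 4 (by decide),
    q 1 2 (by decide), q 1 3 (by decide), q 1 4 (by decide), q 2 3 (by decide), q 2 4 (by decide),
    q 3 4 (by decide)]

theorem cc_vv (h : TD D T) {i j : Fin n} (hij : i ≠ j) :
    vv (rr E T i) (rr E T j) ≤ cc E T i j ∧ cc E T i j % 2 = vv (rr E T i) (rr E T j) % 2 := by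
  have := sum10_wt (T := T) (E.hub i) (E.hub j) E.leaf
  rw [h.ycode_eq E.leaf_inj (E.hl i) (E.hl j) (E.hub_inj.ne hij)] at this
  unfold cc vv
  rw [if_neg hij]
  exact this

theorem cc_one (h : TD D T) {i j : Fin n} (hij : i ≠ j) (h1 : cc E T i j = 1) :
    vv (rr E T i) (rr E T j) = 1 := by
  have := cc_vv E h hij
  omega

theorem cc_two (h : TD D T) {i j : Fin n} (hij : i ≠ j) (h1 : cc E T i j = 2) :
    rr E T i ≠ rr E T j := by
  intro he
  have := cc_vv E h hij
  rw [he, vv_self _ (rr_mem E h j)] at this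
  omega

theorem inj5 {α : Type*} {a b c d e : α} (h1 : a ≠ b) (h2 : a ≠ c) (h3 : a ≠ d) (h4 : a ≠ e)
    (h5 : b ≠ c) (h6 : b ≠ d) (h7 : b ≠ e) (h8 : c ≠ d) (h9 : c ≠ e) (h10 : d ≠ e) :
    Function.Injective ![a, b, c, d, e] := by
  rw [← List.nodup_ofFn]
  simp [List.ofFn_succ, h1, h2, h3, h4, h5, h6, h7, h8, h9, h10, Fin.succ]

set_option maxHeartbeats 800000 in
theorem cc_bad7 (h : TD D T) (t : Fin n) (I : Finset (Fin n)) (hI : I.card = 5) (ht : t ∉ I)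
    (h1 : ∀ i ∈ I, cc E T i t = 1) (h2 : ∀ i ∈ I, ∀ j ∈ I, i ≠ j → cc E T i j = 2) : False := by
  have hinj : Set.InjOn (rr E T) I := by
    intro i hi j hj hij
    by_contra hne
    exact cc_two E h hne (h2 i hi j hj hne) hij
  obtain ⟨a, b, c, d, e, hn⟩ := nbr_five (rr_mem E h t)
  have hsub : I.image (rr E T) ⊆ (nbr (rr E T t)).toFinset := by
    intro x hx
    obtain ⟨i, hi, rfl⟩ := Finset.mem_image.1 hx
    rw [List.mem_toFinset, nbr, List.mem_filter]
    refine ⟨rr_mem E h i, ?_⟩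
    rw [Nat.beq_eq]
    exact cc_one E h (fun he => ht (he ▸ hi)) (h1 i hi)
  have hcard : (I.image (rr E T)).card = 5 := by rw [Finset.card_image_of_injOn hinj, hI]
  have heq : I.image (rr E T) = (nbr (rr E T t)).toFinset := by
    apply Finset.eq_of_subset_of_card_le hsub
    rw [hcard]
    refine (List.toFinset_card_le _).trans ?_
    rw [hn]; rfl
  have hdup : ([a, b, c, d, e] : List ℕ).Nodup := by
    rw [← hn]
    apply List.dedup_eq_self.1
    apply (List.dedup_sublist _).eq_of_length
    have h5 : (nbr (rr E T t)).dedup.length = 5 := by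
      rw [← List.card_toFinset, ← heq, hcard]
    rw [h5, hn]; rfl
  have ex : ∀ x ∈ [a, b, c, d, e], ∃ i ∈ I, rr E T i = x := by
    intro x hx
    rw [← hn, ← List.mem_toFinset, ← heq] at hx
    simpa using hx
  obtain ⟨i0, m0, r0⟩ := ex a (by simp)
  obtain ⟨i1, m1, r1⟩ := ex b (by simp)
  obtain ⟨i2, m2, r2⟩ := ex c (by simp)
  obtain ⟨i3, m3, r3⟩ := ex d (by simp)
  obtain ⟨i4, m4, r4⟩ := ex e (by simp)
  have key : ∀ i ∈ I, ∀ j ∈ I, i ≠ j →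
      (yy T (E.hub i) (E.hub j) (E.leaf 0) (E.leaf 1), yy T (E.hub i) (E.hub j) (E.leaf 0) (E.leaf 2),
      yy T (E.hub i) (E.hub j) (E.leaf 0) (E.leaf 3), yy T (E.hub i) (E.hub j) (E.leaf 0) (E.leaf 4))
      ∈ optl (rr E T i) (rr E T j) := by
    intro i hi j hj hij
    have e2 := h2 i hi j hj hij
    rw [cc, if_neg hij] at e2
    exact mem_optl e2 (h.ycode_eq E.leaf_inj (E.hl i) (E.hl j) (E.hub_inj.ne hij))
  simp only [List.nodup_cons, List.mem_cons, List.not_mem_nil, not_or, or_false] at hdup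
  obtain ⟨⟨d01, d02, d03, d04⟩, ⟨d12, d13, d14⟩, ⟨d23, d24⟩, d34, -⟩ := hdup
  have ne : ∀ {i j : Fin n} {x y : ℕ}, rr E T i = x → rr E T j = y → x ≠ y → i ≠ j := by
    rintro i j x y rfl rfl hxy rfl
    exact hxy rfl
  have n01 := ne r0 r1 d01
  have n02 := ne r0 r2 d02
  have n03 := ne r0 r3 d03
  have n04 := ne r0 r4 d04
  have n12 := ne r1 r2 d12
  have n13 := ne r1 r3 d13
  have n14 := ne r1 r4 d14
  have n23 := ne r2 r3 d23
  have n24 := ne r2 r4 d24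
  have n34 := ne r3 r4 d34
  have k01 := key i0 m0 i1 m1 n01
  have k02 := key i0 m0 i2 m2 n02
  have k03 := key i0 m0 i3 m3 n03
  have k04 := key i0 m0 i4 m4 n04
  have k12 := key i1 m1 i2 m2 n12
  have k13 := key i1 m1 i3 m3 n13
  have k14 := key i1 m1 i4 m4 n14
  have k23 := key i2 m2 i3 m3 n23
  have k24 := key i2 m2 i4 m4 n24
  have k34 := key i3 m3 i4 m4 n34
  rw [r0, r1] at k01
  rw [r0, r2] at k02
  rw [r0, r3] at k03
  rw [r0, r4] at k04
  rw [r1, r2] at k12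
  rw [r1, r3] at k13
  rw [r1, r4] at k14
  rw [r2, r3] at k23
  rw [r2, r4] at k24
  rw [r3, r4] at k34
  let g : Fin 5 → W := ![E.hub i0, E.hub i1, E.hub i2, E.hub i3, E.hub i4]
  have hg : Function.Injective g := by
    have h0 : g = E.hub ∘ ![i0, i1, i2, i3, i4] := by
      funext x; fin_cases x <;> rfl
    rw [h0]
    apply E.hub_inj.comp
    exact inj5 n01 n02 n03 n04 n12 n13 n14 n23 n24 n34
  have hlg : ∀ a k, G.Adj (E.leaf a) (g k) := by
    intro a k
    fin_cases k <;> exact (E.hl _ _).symm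
  have hsm : ∀ a, rcode T (E.leaf a) g ∈ L24 := fun a => h.rcode_mem hg (hlg a)
  have tr : ∀ b, (0 : Fin 5) ≠ b → tri6 (yy T (E.hub i0) (E.hub i1) (E.leaf 0) (E.leaf b))
      (yy T (E.hub i0) (E.hub i2) (E.leaf 0) (E.leaf b)) (yy T (E.hub i0) (E.hub i3) (E.leaf 0) (E.leaf b))
      (yy T (E.hub i0) (E.hub i4) (E.leaf 0) (E.leaf b)) (yy T (E.hub i1) (E.hub i2) (E.leaf 0) (E.leaf b))
      (yy T (E.hub i1) (E.hub i3) (E.leaf 0) (E.leaf b)) (yy T (E.hub i1) (E.hub i4) (E.leaf 0) (E.leaf b))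
      (yy T (E.hub i2) (E.hub i3) (E.leaf 0) (E.leaf b)) (yy T (E.hub i2) (E.hub i4) (E.leaf 0) (E.leaf b))
      (yy T (E.hub i3) (E.hub i4) (E.leaf 0) (E.leaf b)) = 63 ^^^ rcode T (E.leaf 0) g ^^^ rcode T (E.leaf b) g := by
    intro b hb
    rw [← h.ycode_eq hg (hlg 0) (hlg b) (E.leaf_inj.ne hb)]
    have dual : ∀ i j, i ≠ j → yy T (E.hub i) (E.hub j) (E.leaf 0) (E.leaf b) =
        yy T (E.leaf 0) (E.leaf b) (E.hub i) (E.hub j) := fun i j hij =>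
      (h.yy_dual (E.hl i 0) (E.hl i b) (E.hl j 0) (E.hl j b) (E.hub_inj.ne hij) (E.leaf_inj.ne hb)).symm
    rw [dual _ _ n01, dual _ _ n02, dual _ _ n03, dual _ _ n04, dual _ _ n12, dual _ _ n13, dual _ _ n14,
      dual _ _ n23, dual _ _ n24, dual _ _ n34]
    rfl
  exact vv7core (rr_mem E h t) hn k01 k02 k03 k04 k12 k13 k14 k23 k24 k34 (hsm 0) (hsm 1) (hsm 2)
    (hsm 3) (hsm 4) (tr 1 (by decide)) (tr 2 (by decide)) (tr 3 (by decide)) (tr 4 (by decide))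

theorem cc_kleitman (h : TD D T) (S : Finset (Fin n)) : 2 * z5 S.card ≤ tot (cc E T) S := by
  refine kleitman (cc E T) (cc_symm E h) (fun i => by simp [cc]) ?_ (fun i => wt (63 ^^^ rr E T i)) ?_ ?_
    (cc_bad7 E h) _ S rfl
  · intro i j k h1 h2 h3
    have := vv3 (rr_mem E h i) (rr_mem E h j) (rr_mem E h k)
    have a1 := (cc_vv E h h1).1
    have a2 := (cc_vv E h h2).1
    have a3 := (cc_vv E h h3).1
    omega
  · intro i j hij
    rw [(cc_vv E h hij).2, vv_par _ (rr_mem E h i) _ (rr_mem E h j)]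
  · intro t t' i j k htt hij hjk hik it jt kt it' jt' kt' c0 c1 c2 c3 c4 c5 c6 c7 c8 c9
    exact vv5 (rr_mem E h t) (rr_mem E h t') (rr_mem E h i) (rr_mem E h j) (rr_mem E h k)
      (cc_two E h htt c0) (cc_two E h hij c7) (cc_two E h hjk c8) (cc_two E h hik c9)
      (cc_one E h it c1) (cc_one E h jt c2) (cc_one E h kt c3)
      (cc_one E h it' c4) (cc_one E h jt' c5) (cc_one E h kt' c6)
end Lower2

section Lower3
variable {W : Type*} {G : SimpleGraph W} {n : ℕ} (E : Emb G n) {D : Drawing G} {T : W → W → W → ℝ}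

noncomputable def xx (T : W → W → W → ℝ) (k : Fin n) (m : Fin 18) : Bool :=
  par T (E.leaf (B18 m).1) (E.leaf (B18 m).2.1) (E.hub k) (E.leaf (B18 m).2.2)

noncomputable def uu (T : W → W → W → ℝ) (k : Fin n) : ℕ := ∑ m, (xx E T k m).toNat

noncomputable def bb (T : W → W → W → ℝ) : ℕ :=
  ∑ k, (par T (E.leaf 0) (E.leaf (C6 k).1) (E.leaf 1) (E.leaf (C6 k).2)).toNat

theorem B18_surj : ∀ p q r : Fin 5, p < 2 → 2 ≤ q → r ≠ p → r ≠ q → ∃ m, B18 m = (p, q, r) := by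
  decide

theorem uu_zero {i : Fin n} (hu : uu E T i = 0) (p q r : Fin 5) (hp : p < 2) (hq : 2 ≤ q)
    (h1 : r ≠ p) (h2 : r ≠ q) : par T (E.leaf p) (E.leaf q) (E.hub i) (E.leaf r) = false := by
  obtain ⟨m, hm⟩ := B18_surj p q r hp hq h1 h2
  have := (Finset.sum_eq_zero_iff.1 hu) m (Finset.mem_univ m)
  rw [xx, hm] at this
  simpa using this

theorem uu_zero' (h : TD D T) {i : Fin n} (hu : uu E T i = 0) (p q r : Fin 5) (hp : p < 2) (hq : 2 ≤ q)
    (h1 : r ≠ p) (h2 : r ≠ q) : par T (E.hub i) (E.leaf r) (E.leaf p) (E.leaf q) = false := by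
  rw [h.par_swap (E.ll p q hp hq) (E.hl i r) (E.hl i p).ne' (E.leaf_inj.ne h1.symm)
    (E.hl i q).ne' (E.leaf_inj.ne h2.symm)]
  exact uu_zero E hu p q r hp hq h1 h2

theorem bb_pos (h : TD D T) {i : Fin n} (hu : uu E T i = 0) : 1 ≤ bb E T := by
  by_contra hb
  have hb : bb E T = 0 := by omega
  have hc : ∀ k, par T (E.leaf 0) (E.leaf (C6 k).1) (E.leaf 1) (E.leaf (C6 k).2) = false := by
    intro k
    have := (Finset.sum_eq_zero_iff.1 hb) k (Finset.mem_univ k)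
    simpa using this
  have q : ∀ {a b : Fin 5}, a ≠ b → E.leaf a ≠ E.leaf b := fun hab => E.leaf_inj.ne hab
  have z := fun p q r h1 h2 h3 h4 => uu_zero' E h hu p q r h1 h2 h3 h4
  have e0 := h.R1 (E.hl i 2) (E.hl i 3) (E.hl i 4) (E.ll 0 2 (by decide) (by decide))
    (E.ll 0 3 (by decide) (by decide)) (E.ll 0 4 (by decide) (by decide)) (E.hl i 0).ne
    (q (by decide)) (q (by decide)) (q (by decide))
  have e1 := h.R1 (E.hl i 2) (E.hl i 3) (E.hl i 4) (E.ll 1 2 (by decide) (by decide))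
    (E.ll 1 3 (by decide) (by decide)) (E.ll 1 4 (by decide) (by decide)) (E.hl i 1).ne
    (q (by decide)) (q (by decide)) (q (by decide))
  have e2 := h.R1 (E.ll 0 2 (by decide) (by decide))
    (E.ll 0 3 (by decide) (by decide)) (E.ll 0 4 (by decide) (by decide))
    (E.ll 1 2 (by decide) (by decide))
    (E.ll 1 3 (by decide) (by decide)) (E.ll 1 4 (by decide) (by decide)) (q (by decide))
    (q (by decide)) (q (by decide)) (q (by decide))
  have c0 := hc 0
  have c1 := hc 1
  have c2 := hc 2
  have c3 := hc 3
  have c4 := hc 4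
  have c5 := hc 5
  simp only [C6] at c0 c1 c2 c3 c4 c5
  simp at c0 c1 c2 c3 c4 c5
  simp only [yy] at e0 e1 e2
  rw [c0, c1, c2, c3, c4, c5] at e2
  rw [z 0 3 2 (by decide) (by decide) (by decide) (by decide),
    z 0 2 3 (by decide) (by decide) (by decide) (by decide),
    z 0 2 4 (by decide) (by decide) (by decide) (by decide),
    z 0 4 2 (by decide) (by decide) (by decide) (by decide),
    z 0 4 3 (by decide) (by decide) (by decide) (by decide),
    z 0 3 4 (by decide) (by decide) (by decide) (by decide)] at e0
  rw [z 1 3 2 (by decide) (by decide) (by decide) (by decide),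
    z 1 2 3 (by decide) (by decide) (by decide) (by decide),
    z 1 2 4 (by decide) (by decide) (by decide) (by decide),
    z 1 4 2 (by decide) (by decide) (by decide) (by decide),
    z 1 4 3 (by decide) (by decide) (by decide) (by decide),
    z 1 3 4 (by decide) (by decide) (by decide) (by decide)] at e1
  revert e0 e1 e2
  generalize sg T (E.hub i) _ _ _ = A
  generalize sg T (E.leaf 0) _ _ _ = B
  generalize sg T (E.leaf 1) _ _ _ = C
  revert A B C
  decide

/-- index into B18 -/
def ix (p q r : Fin 5) : Fin 18 :=
  match (List.finRange 18).find? (fun m => B18 m = (p, q, r)) with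
  | some m => m
  | none => 0

theorem B18_ix : ∀ p q r : Fin 5, p < 2 → 2 ≤ q → r ≠ p → r ≠ q → B18 (ix p q r) = (p, q, r) := by
  decide

def qx (x : Fin 18 → Bool) (b b' b'' : Fin 5) : Bool :=
  x (ix 1 b 0) ^^ x (ix 1 b b') ^^ x (ix 1 b' 0) ^^ x (ix 1 b' b) ^^ x (ix 1 b'' b) ^^
    x (ix 1 b'' b') ^^ x (ix 0 b'' b) ^^ x (ix 0 b'' b')

def fx (x : Fin 18 → Bool) (b b' : Fin 5) : Bool :=
  x (ix 0 b 1) ^^ x (ix 0 b b') ^^ x (ix 1 b' 0) ^^ x (ix 1 b' b)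

def gx (x : Fin 18 → Bool) : ℕ :=
  code6 (!(qx x 2 3 4) ^^ fx x 2 3) (!(qx x 3 2 4) ^^ fx x 3 2) (!(qx x 4 2 3) ^^ fx x 4 2)
    (!(qx x 2 3 4)) (!(qx x 2 4 3)) (!(qx x 3 4 2))

def okx (x : Fin 18 → Bool) : Bool :=
  (!(qx x 4 2 3) ^^ fx x 4 2) == (!(qx x 4 3 2) ^^ fx x 4 3)

theorem gx_one : ∀ m : Option (Fin 18), okx (fun j => decide (some j = m)) = true → 4 ≤ wt (gx (fun j => decide (some j = m))) +
    2 * ∑ j, (decide (some j = m)).toNat := by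
  decide +kernel

theorem gx_bound (x : Fin 18 → Bool) (hok : okx x = true) : 4 ≤ wt (gx x) + 2 * ∑ m, (x m).toNat := by
  by_cases h2 : 2 ≤ ∑ m, (x m).toNat
  · omega
  have hx : ∃ m : Option (Fin 18), x = fun j => decide (some j = m) := by
    by_cases h0 : ∃ a, x a = true
    · obtain ⟨a, ha⟩ := h0
      refine ⟨some a, ?_⟩
      funext j
      by_cases hj : j = a
      · simp [hj, ha]
      · simp only [Option.some.injEq, hj, decide_false]
        by_contra hne
        have hne : x j = true := by simpa using hne
        apply h2
        have := Finset.sum_le_sum_of_subset (f := fun m => (x m).toNat) (Finset.subset_univ {j, a})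
        rw [Finset.sum_pair hj, hne, ha] at this
        exact this
    · push Not at h0
      refine ⟨none, ?_⟩
      funext j
      simpa using h0 j
  obtain ⟨m, rfl⟩ := hx
  exact gx_one m hok

theorem lemG (h : TD D T) {i k : Fin n} (hik : k ≠ i) (hu : uu E T i = 0) :
    4 ≤ cc E T i k + 2 * uu E T k := by
  suffices hs : okx (xx E T k) = true ∧ ycode T (E.hub i) (E.hub k) E.leaf = gx (xx E T k) by
    obtain ⟨hok, hs⟩ := hs
    have hb := gx_bound (xx E T k) hok
    have := (sum10_wt (T := T) (E.hub i) (E.hub k) E.leaf).1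
    rw [cc, if_neg hik.symm]
    rw [hs] at this
    unfold uu
    omega
  have q : ∀ {a b : Fin 5}, a ≠ b → E.leaf a ≠ E.leaf b := fun hab => E.leaf_inj.ne hab
  have z := fun p q r h1 h2 h3 h4 => uu_zero E hu p q r h1 h2 h3 h4
  have z' := fun p q r h1 h2 h3 h4 => uu_zero' E h hu p q r h1 h2 h3 h4
  have hx : ∀ p q r : Fin 5, p < 2 → 2 ≤ q → r ≠ p → r ≠ q → xx E T k (ix p q r) =
      par T (E.leaf p) (E.leaf q) (E.hub k) (E.leaf r) := by
    intro p q r h1 h2 h3 h4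
    rw [xx, B18_ix p q r h1 h2 h3 h4]
  have hne : E.hub i ≠ E.hub k := E.hub_inj.ne hik.symm
  have key1 : ∀ b b' b'' : Fin 5, 2 ≤ b → 2 ≤ b' → 2 ≤ b'' → b ≠ b' → b ≠ b'' → b' ≠ b'' →
      (yy T (E.hub i) (E.hub k) (E.leaf 0) (E.leaf b) ^^ yy T (E.hub i) (E.hub k) (E.leaf 0) (E.leaf b')
        ^^ yy T (E.hub i) (E.hub k) (E.leaf b) (E.leaf b')) = !(qx (xx E T k) b b' b'') := by
    intro b b' b'' g g' g'' n1 n2 n3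
    have l0 : ∀ {x : Fin 5}, 2 ≤ x → (0 : Fin 5) ≠ x := by decide
    have l1 : ∀ {x : Fin 5}, 2 ≤ x → (1 : Fin 5) ≠ x := by decide
    rw [h.R1 (E.hl _ _) (E.hl _ _) (E.hl _ _) (E.hl _ _) (E.hl _ _) (E.hl _ _) hne (q (l0 g)) (q n1)
      (q (l0 g'))]
    rw [← h.tripod (c := E.leaf 1) (b'' := E.leaf b'')
      ⟨E.hl _ _, E.hl _ _, E.hl _ _, (E.hl _ _).ne, (E.hl _ _).ne⟩
      ⟨E.hl _ _, E.hl _ _, E.hl _ _, (E.hl _ _).ne, (E.hl _ _).ne⟩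
      (E.ll _ _ (by decide) g) (E.ll _ _ (by decide) g') (E.ll _ _ (by decide) g'')
      (q (l0 g)) (q (l0 g')) (E.ll _ _ (by decide) g'') (q n1) (q n2) (q n3) (q (by decide))]
    have t0 : Qp T (E.hub i) (E.leaf 0) (E.leaf 1) (E.leaf b) (E.leaf b') (E.leaf b'') = false := by
      unfold Qp
      rw [z 1 b 0 (by decide) g (by decide) (l0 g), z 1 b b' (by decide) g (l1 g').symm n1.symm,
        z 1 b' 0 (by decide) g' (by decide) (l0 g'), z 1 b' b (by decide) g' (l1 g).symm n1,
        z 1 b'' b (by decide) g'' (l1 g).symm n2, z 1 b'' b' (by decide) g'' (l1 g').symm n3,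
        z 0 b'' b (by decide) g'' (l0 g).symm n2, z 0 b'' b' (by decide) g'' (l0 g').symm n3]
      rfl
    have t1 : Qp T (E.hub k) (E.leaf 0) (E.leaf 1) (E.leaf b) (E.leaf b') (E.leaf b'') =
        qx (xx E T k) b b' b'' := by
      unfold Qp qx
      rw [hx 1 b 0 (by decide) g (by decide) (l0 g), hx 1 b b' (by decide) g (l1 g').symm n1.symm,
        hx 1 b' 0 (by decide) g' (by decide) (l0 g'), hx 1 b' b (by decide) g' (l1 g).symm n1,
        hx 1 b'' b (by decide) g'' (l1 g).symm n2, hx 1 b'' b' (by decide) g'' (l1 g').symm n3,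
        hx 0 b'' b (by decide) g'' (l0 g).symm n2, hx 0 b'' b' (by decide) g'' (l0 g').symm n3]
    rw [t0, t1, Bool.false_xor]
  have key2 : ∀ b b' : Fin 5, 2 ≤ b → 2 ≤ b' → b ≠ b' →
      (yy T (E.hub i) (E.hub k) (E.leaf 0) (E.leaf 1) ^^ yy T (E.hub i) (E.hub k) (E.leaf 0) (E.leaf b')
        ^^ yy T (E.hub i) (E.hub k) (E.leaf 1) (E.leaf b) ^^
        yy T (E.hub i) (E.hub k) (E.leaf b) (E.leaf b')) = fx (xx E T k) b b' := by
    intro b b' g g' n1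
    have l0 : ∀ {x : Fin 5}, 2 ≤ x → (0 : Fin 5) ≠ x := by decide
    have l1 : ∀ {x : Fin 5}, 2 ≤ x → (1 : Fin 5) ≠ x := by decide
    have t1 := h.triangles (E.hl i 0) (E.ll 0 b (by decide) g) (E.hl i b) (E.hl k 1)
      (E.ll 1 b' (by decide) g') (E.hl k b') hne (E.hl _ _).ne (E.hl _ _).ne (E.hl _ _).ne'
      (q (by decide)) (q (l0 g')) (E.hl _ _).ne' (q (l1 g).symm) (q n1)
    have t2 := h.triangles (E.hl i 1) (E.ll 1 b' (by decide) g') (E.hl i b') (E.hl k 0)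
      (E.ll 0 b (by decide) g) (E.hl k b) hne (E.hl _ _).ne (E.hl _ _).ne (E.hl _ _).ne'
      (q (by decide)) (q (l1 g)) (E.hl _ _).ne' (q (l0 g').symm) (q n1.symm)
    rw [h.par_swap (E.ll 0 b (by decide) g) (E.ll 1 b' (by decide) g') (q (by decide)) (q (l0 g'))
      (q (l1 g).symm) (q n1), z' 0 b 1 (by decide) g (by decide) (l1 g),
      z' 0 b b' (by decide) g (l0 g').symm n1.symm] at t2
    rw [z' 1 b' 0 (by decide) g' (by decide) (l0 g'), z' 1 b' b (by decide) g' (l1 g).symm n1] at t1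
    unfold fx yy
    rw [hx 0 b 1 (by decide) g (by decide) (l1 g), hx 0 b b' (by decide) g (l0 g').symm n1.symm,
      hx 1 b' 0 (by decide) g' (by decide) (l0 g'), hx 1 b' b (by decide) g' (l1 g).symm n1]
    generalize par T (E.hub i) (E.leaf 0) (E.hub k) (E.leaf 1) = a1 at *
    generalize par T (E.hub i) (E.leaf 1) (E.hub k) (E.leaf 0) = a2 at *
    generalize par T (E.hub i) (E.leaf 0) (E.hub k) (E.leaf b') = a3 at *
    generalize par T (E.hub i) (E.leaf b') (E.hub k) (E.leaf 0) = a4 at *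
    generalize par T (E.hub i) (E.leaf 1) (E.hub k) (E.leaf b) = a5 at *
    generalize par T (E.hub i) (E.leaf b) (E.hub k) (E.leaf 1) = a6 at *
    generalize par T (E.hub i) (E.leaf b) (E.hub k) (E.leaf b') = a7 at *
    generalize par T (E.hub i) (E.leaf b') (E.hub k) (E.leaf b) = a8 at *
    generalize par T (E.leaf 0) (E.leaf b) (E.hub k) (E.leaf 1) = b1 at *
    generalize par T (E.leaf 0) (E.leaf b) (E.hub k) (E.leaf b') = b2 at *
    generalize par T (E.leaf 1) (E.leaf b') (E.hub k) (E.leaf 0) = b3 at *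
    generalize par T (E.leaf 1) (E.leaf b') (E.hub k) (E.leaf b) = b4 at *
    generalize par T (E.leaf 0) (E.leaf b) (E.leaf 1) (E.leaf b') = b5 at *
    clear hx z z' q
    revert t1 t2
    clear * -
    revert a1 a2 a3 a4 a5 a6 a7 a8 b1 b2 b3 b4 b5
    decide +kernel
  have bx : ∀ A B C B' D' : Bool, (A ^^ B ^^ C) = ((B ^^ B' ^^ D') ^^ (A ^^ B' ^^ C ^^ D')) := by decide
  have a1 := key1 2 3 4 (by decide) (by decide) (by decide) (by decide) (by decide) (by decide)
  have a2 := key1 3 2 4 (by decide) (by decide) (by decide) (by decide) (by decide) (by decide)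
  have a3 := key1 4 2 3 (by decide) (by decide) (by decide) (by decide) (by decide) (by decide)
  have a4 := key1 2 4 3 (by decide) (by decide) (by decide) (by decide) (by decide) (by decide)
  have a5 := key1 3 4 2 (by decide) (by decide) (by decide) (by decide) (by decide) (by decide)
  have f1 := key2 2 3 (by decide) (by decide) (by decide)
  have f2 := key2 3 2 (by decide) (by decide) (by decide)
  have f3 := key2 4 2 (by decide) (by decide) (by decide)
  have a6 := key1 4 3 2 (by decide) (by decide) (by decide) (by decide) (by decide) (by decide)
  have f4 := key2 4 3 (by decide) (by decide) (by decide)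
  refine ⟨?_, ?_⟩
  · unfold okx
    rw [← f3, ← f4, ← a3, ← a6, ← bx, ← bx, beq_self_eq_true]
  unfold ycode tri6 gx
  rw [← f1, ← f2, ← f3, ← a1, ← a2, ← a3, ← a4, ← a5, ← bx, ← bx, ← bx]

theorem toNat_xor_le : ∀ a b : Bool, (a ^^ b).toNat ≤ a.toNat + b.toNat := by decide

theorem lower (E : Emb G n) (hn : 0 < n) [Finite W] (hD : D.IsGood) : z5 n + n ≤ D.crNum := by
  obtain ⟨T, h1, h2, h3⟩ := tdata hD
  have h : TD D T := ⟨h1, h2, h3⟩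
  have hge := crNum_ge E hD h
  have hf := final_bound hn (cc E T) (uu E T) (bb E T) (cc_symm E h) (fun i => by simp [cc])
    (cc_kleitman E h) (fun i hi => ⟨bb_pos E h hi, fun k hk => lemG E h hk hi⟩)
  rw [sum_lt_double _ (cc_symm E h) (fun i => by simp [cc])] at hf
  rw [Fintype.sum_sum_type, Fintype.sum_sum_type, Fintype.sum_prod_type, Fintype.sum_prod_type] at hge
  simp only [Fintype.sum_prod_type] at hge
  have e1 : ∑ i, ∑ j, (if i < j then cc E T i j else 0) ≤
      ∑ i, ∑ j, ∑ k, (evVal E T (Sum.inl (i, j, k))).toNat := by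
    apply Finset.sum_le_sum; intro i _
    apply Finset.sum_le_sum; intro j _
    split_ifs with hij
    · rw [cc, if_neg hij.ne, sum10]
      simp only [evVal, hij, decide_true, Bool.true_and]
      simp only [Fin.sum_univ_succ, P20, yy]
      simp only [Fin.sum_univ_zero, Finset.univ_eq_empty, Finset.sum_empty]
      have tx := toNat_xor_le
      simp [Fin.succ]
      have q := fun a b : Fin 5 => tx (par T (E.hub i) (E.leaf a) (E.hub j) (E.leaf b))
        (par T (E.hub i) (E.leaf b) (E.hub j) (E.leaf a))
      have q1 := q 0 1
      have q2 := q 0 2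
      have q3 := q 0 3
      have q4 := q 0 4
      have q5 := q 1 2
      have q6 := q 1 3
      have q7 := q 1 4
      have q8 := q 2 3
      have q9 := q 2 4
      have q10 := q 3 4
      omega
    · exact Nat.zero_le _
  have e2 : ∑ i, uu E T i = ∑ i, ∑ m, (evVal E T (Sum.inr (Sum.inl (i, m)))).toNat := rfl
  have e3 : bb E T = ∑ m, (evVal E T (Sum.inr (Sum.inr m))).toNat := rfl
  omega

end Lower3

section Upper

def lx : Fin 5 → ℝ := ![-3, -2, 2, 3, 6]
def hh (i : ℕ) : ℝ := (-2) ^ i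

theorem hh_even {i : ℕ} (h : i % 2 = 0) : hh i = 2 ^ i := by
  rw [hh, Even.neg_pow (Nat.even_iff.2 h)]
theorem hh_odd {i : ℕ} (h : i % 2 = 1) : hh i = - 2 ^ i := by
  rw [hh, Odd.neg_pow (Nat.odd_iff.2 h)]
theorem one_le_two_pow' (i : ℕ) : (1 : ℝ) ≤ 2 ^ i := one_le_pow₀ (by norm_num)

theorem hub_lt {i j : ℕ} {s t : ℝ} (hs : 0 < s) (hst : s < t) (h : hh i * s = hh j * t) :
    i % 2 = j % 2 ∧ j < i := by
  have p1 := one_le_two_pow' i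
  have p2 := one_le_two_pow' j
  have key : (2 : ℝ) ^ i * s = 2 ^ j * t → j < i := by
    intro he
    by_contra hle
    have : (2 : ℝ) ^ i ≤ 2 ^ j := pow_le_pow_right₀ (by norm_num) (by omega)
    nlinarith
  rcases Nat.mod_two_eq_zero_or_one i with hi | hi <;> rcases Nat.mod_two_eq_zero_or_one j with hj | hj
  · rw [hh_even hi, hh_even hj] at h
    exact ⟨by omega, key h⟩
  · rw [hh_even hi, hh_odd hj] at h
    nlinarith
  · rw [hh_odd hi, hh_even hj] at h
    nlinarith
  · rw [hh_odd hi, hh_odd hj] at h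
    exact ⟨by omega, key (by linarith)⟩

theorem hub_ne (i : ℕ) : hh i ≠ 0 := pow_ne_zero _ (by norm_num)

theorem hh_inj {i j : ℕ} (h : hh i = hh j) : i = j := by
  have h2 : |hh i| = |hh j| := by rw [h]
  simp only [hh, abs_pow, abs_neg, abs_two] at h2
  exact pow_right_injective₀ (by norm_num : (0:ℝ) < 2) (by norm_num) h2

/-- hub heights at the same side at least double -/
theorem hub_double {i j : ℕ} {s t : ℝ} (hs : 0 < s) (h : hh i * s = hh j * t)
    (hp : i % 2 = j % 2) (hji : j < i) : 2 * s ≤ t := by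
  have e : (2 : ℝ) ^ i * s = 2 ^ j * t := by
    rcases Nat.mod_two_eq_zero_or_one i with hi | hi
    · rwa [hh_even hi, hh_even (by omega)] at h
    · rw [hh_odd hi, hh_odd (by omega)] at h
      linarith
  have : (2 : ℝ) ^ (j + 1) ≤ 2 ^ i := pow_le_pow_right₀ (by norm_num) (by omega)
  rw [pow_succ] at this
  have p2 := one_le_two_pow' j
  by_contra hc
  push Not at hc
  nlinarith

theorem hub_side (i : ℕ) : (i % 2 = 0 ∧ 1 ≤ hh i) ∨ (i % 2 = 1 ∧ hh i ≤ -1) := by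
  have p1 := one_le_two_pow' i
  rcases Nat.mod_two_eq_zero_or_one i with hi | hi
  · left; exact ⟨hi, by rw [hh_even hi]; exact p1⟩
  · right; exact ⟨hi, by rw [hh_odd hi]; linarith⟩

theorem hub_M {n i : ℕ} (h : i < n) : hh i < 2 ^ n := by
  have p1 := one_le_two_pow' i
  have : (2 : ℝ) ^ i < 2 ^ n := pow_lt_pow_right₀ (by norm_num) h
  rcases Nat.mod_two_eq_zero_or_one i with hi | hi
  · rw [hh_even hi]; exact this
  · rw [hh_odd hi]; linarith

def LP : Fin 6 → Fin 5 := ![0, 0, 0, 1, 2, 3]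
def LQ : Fin 6 → Fin 5 := ![1, 2, 4, 3, 3, 4]
noncomputable def LK (n : ℕ) : Fin 6 → ℝ := ![0, -(1/100), 2 ^ n, 1/100, 0, 0]

abbrev Ed (n : ℕ) := (Fin n × Fin 5) ⊕ Fin 6

def opn {n : ℕ} : Ed n → ℝ × ℝ → Prop
  | .inl (i, a), p => ∃ s, 0 < s ∧ s < 1 ∧ p = (lx a * s, hh i * (1 - s))
  | .inr m, p => lx (LP m) < p.1 ∧ p.1 < lx (LQ m) ∧
      p.2 = LK n m * ((p.1 - lx (LP m)) * (lx (LQ m) - p.1))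

def inn (a b : Fin 5) : Prop := (a = 1 ∧ b = 0) ∨ (a = 2 ∧ b = 3) ∨ (a = 2 ∧ b = 4) ∨ (a = 3 ∧ b = 4)

def CrH {n : ℕ} (i : Fin n) (a : Fin 5) (m : Fin 6) : Prop :=
  (i.val % 2 = 0 ∧ a = 2 ∧ m = 3) ∨ (i.val % 2 = 1 ∧ a = 1 ∧ m = 1)

def Cr {n : ℕ} : Ed n → Ed n → Prop
  | .inl (i, a), .inl (j, b) => i.val % 2 = j.val % 2 ∧ ((inn a b ∧ j < i) ∨ (inn b a ∧ i < j))
  | .inl (i, a), .inr m => CrH i a m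
  | .inr m, .inl (i, a) => CrH i a m
  | .inr _, .inr _ => False

theorem cr_hh {n : ℕ} {i j : Fin n} {a b : Fin 5} {p : ℝ × ℝ} (h1 : opn (.inl (i, a)) p)
    (h2 : opn (.inl (j, b)) p) (hne : (i, a) ≠ (j, b)) : Cr (.inl (i, a)) (.inl (j, b)) := by
  obtain ⟨s, s0, s1, rfl⟩ := h1
  obtain ⟨t, t0, t1, he⟩ := h2
  rw [Prod.mk.injEq] at he
  obtain ⟨hx, hy⟩ := he
  by_cases hab : a = b
  · subst hab
    have hl : lx a ≠ 0 := by fin_cases a <;> simp [lx]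
    have hst := mul_left_cancel₀ hl hx
    subst hst
    have := mul_right_cancel₀ (by linarith : (1 - s) ≠ 0) hy
    exact absurd (by rw [Fin.ext (hh_inj this)]) hne
  have k1 : t < s → i.val % 2 = j.val % 2 ∧ j < i := fun h =>
    hub_lt (by linarith) (by linarith) hy
  have k2 : s < t → i.val % 2 = j.val % 2 ∧ i < j := fun h => by
    have := hub_lt (by linarith) (by linarith) hy.symm
    exact ⟨this.1.symm, this.2⟩
  have main : (inn a b ∧ t < s) ∨ (inn b a ∧ s < t) := by
    clear k1 k2 hy hne
    fin_cases a <;> fin_cases b <;> simp [lx] at hab hx <;> simp [inn] <;> linarith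
  rcases main with ⟨m1, m2⟩ | ⟨m1, m2⟩
  · exact ⟨(k1 m2).1, .inl ⟨m1, (k1 m2).2⟩⟩
  · exact ⟨(k2 m2).1, .inr ⟨m1, (k2 m2).2⟩⟩

theorem cr_hl {n : ℕ} {i : Fin n} {a : Fin 5} {m : Fin 6} {p : ℝ × ℝ} (h1 : opn (.inl (i, a)) p)
    (h2 : opn (n := n) (.inr m) p) : CrH i a m := by
  obtain ⟨s, s0, s1, rfl⟩ := h1
  obtain ⟨x1, x2, hy⟩ := h2
  simp only at x1 x2 hy
  have hM := hub_M i.2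
  have hs := hub_side i
  have h0 := hub_ne i
  have hM1 := one_le_two_pow' n
  generalize hh i = h at *
  have hc : 0 < 1 - s := by linarith
  have hz : h * (1 - s) ≠ 0 := mul_ne_zero h0 hc.ne'
  have hpos : 0 < (lx a * s - lx (LP m)) * (lx (LQ m) - lx a * s) :=
    mul_pos (by linarith) (by linarith)
  have hm : LK n m ≠ 0 := by
    intro h; rw [h, zero_mul] at hy; exact hz hy
  have hm3 : m = 1 ∨ m = 2 ∨ m = 3 := by
    revert hm; fin_cases m <;> simp [LK]
  rcases hm3 with rfl | rfl | rfl
  · simp [LK, LP, LQ, lx] at hy x1 x2 hpos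
    have hneg : h * (1 - s) < 0 := by rw [hy]; linarith
    have hh1 : i.val % 2 = 1 ∧ h ≤ -1 := by
      rcases hs with hs | hs
      · nlinarith
      · exact hs
    refine Or.inr ⟨hh1.1, ?_, rfl⟩
    have h3 : h * (1 - s) ≤ -(1 - s) := by nlinarith
    fin_cases a <;> simp at hy x1 x2 ⊢ <;> nlinarith
  · exfalso
    simp [LK, LP, LQ, lx] at hy x1 x2 hpos
    have h3 : h * (1 - s) < 2 ^ n * (1 - s) := by nlinarith
    rw [hy] at h3
    have h4 := lt_of_mul_lt_mul_left h3 (by linarith)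
    fin_cases a <;> simp at h4 <;> nlinarith
  · simp [LK, LP, LQ, lx] at hy x1 x2 hpos
    have hneg : 0 < h * (1 - s) := by rw [hy]; linarith
    have hh1 : i.val % 2 = 0 ∧ 1 ≤ h := by
      rcases hs with hs | hs
      · exact hs
      · nlinarith
    refine Or.inl ⟨hh1.1, ?_, rfl⟩
    have h3 : (1 - s) ≤ h * (1 - s) := by nlinarith
    fin_cases a <;> simp at hy x1 x2 ⊢ <;> nlinarith

theorem cr_ll {n : ℕ} {m m' : Fin 6} {p : ℝ × ℝ} (h1 : opn (n := n) (.inr m) p)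
    (h2 : opn (n := n) (.inr m') p) : m = m' := by
  obtain ⟨x, y⟩ := p
  obtain ⟨x1, x2, hy⟩ := h1
  obtain ⟨x3, x4, hy'⟩ := h2
  simp only at x1 x2 x3 x4 hy hy'
  rw [hy] at hy'
  clear hy
  have q1 : 0 < (x - lx (LP m)) * (lx (LQ m) - x) := mul_pos (by linarith) (by linarith)
  have q2 : 0 < (x - lx (LP m')) * (lx (LQ m') - x) := mul_pos (by linarith) (by linarith)
  have hM1 := one_le_two_pow' n
  fin_cases m <;> fin_cases m' <;> simp [LK, LP, LQ, lx] at * <;> 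
    first | linarith | (rcases hy' with hy' | hy' <;> linarith) | nlinarith

end Upper

section Upper2

theorem cr_of {n : ℕ} {x y : Ed n} {p : ℝ × ℝ} (h1 : opn x p) (h2 : opn y p) (hne : x ≠ y) :
    Cr x y := by
  rcases x with ⟨i, a⟩ | m <;> rcases y with ⟨j, b⟩ | m'
  · exact cr_hh h1 h2 (fun h => hne (by rw [h]))
  · exact cr_hl h1 h2
  · exact cr_hl h2 h1
  · exact hne (by rw [cr_ll h1 h2])

theorem once_hl {n : ℕ} {i : Fin n} {a : Fin 5} {m : Fin 6} {p q : ℝ × ℝ}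
    (h1 : opn (.inl (i, a)) p) (h2 : opn (n := n) (.inr m) p)
    (h3 : opn (.inl (i, a)) q) (h4 : opn (n := n) (.inr m) q) : p = q := by
  have hc := cr_hl h1 h2
  obtain ⟨s, s0, s1, rfl⟩ := h1
  obtain ⟨t, t0, t1, rfl⟩ := h3
  obtain ⟨-, -, hy⟩ := h2
  obtain ⟨-, -, hy'⟩ := h4
  simp only at hy hy'
  suffices s = t by rw [this]
  by_contra hst
  have hst' : s - t ≠ 0 := sub_ne_zero.2 hst
  have hs := hub_side i
  generalize hh i = h at *
  rcases hc with ⟨hi, rfl, rfl⟩ | ⟨hi, rfl, rfl⟩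
  · have hh1 : 1 ≤ h := by
      rcases hs with hs | hs
      · exact hs.2
      · omega
    simp [LK, LP, LQ, lx] at hy hy'
    have : (s - t) * (h + (1/100) * (2 - 4 * (s + t))) = 0 := by nlinarith
    have := (mul_eq_zero.1 this).resolve_left hst'
    linarith
  · have hh1 : h ≤ -1 := by
      rcases hs with hs | hs
      · omega
      · exact hs.2
    simp [LK, LP, LQ, lx] at hy hy'
    have : (s - t) * (h - (1/100) * (2 - 4 * (s + t))) = 0 := by nlinarith
    have := (mul_eq_zero.1 this).resolve_left hst'
    linarith

theorem once_hh {n : ℕ} {i j : Fin n} {a b : Fin 5} {p q : ℝ × ℝ} (hne : (i, a) ≠ (j, b))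
    (h1 : opn (.inl (i, a)) p) (h2 : opn (.inl (j, b)) p)
    (h3 : opn (.inl (i, a)) q) (h4 : opn (.inl (j, b)) q) : p = q := by
  have hc := cr_hh h1 h2 hne
  obtain ⟨s, s0, s1, rfl⟩ := h1
  obtain ⟨t, t0, t1, rfl⟩ := h3
  obtain ⟨s', s0', s1', e1⟩ := h2
  obtain ⟨t', t0', t1', e2⟩ := h4
  rw [Prod.mk.injEq] at e1 e2
  obtain ⟨e1, e1'⟩ := e1
  obtain ⟨e2, e2'⟩ := e2
  suffices s = t by rw [this]
  by_contra hst
  have hst' : s - t ≠ 0 := sub_ne_zero.2 hst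
  have k1 : lx a * (s - t) = lx b * (s' - t') := by linarith
  have k2 : hh i * (s - t) = hh j * (s' - t') := by linarith
  have k3 : (lx a * hh j - lx b * hh i) * (s - t) = 0 := by
    have : lx a * (s - t) * hh j = lx b * (s' - t') * hh j := by rw [k1]
    have : hh i * (s - t) * lx b = hh j * (s' - t') * lx b := by rw [k2]
    linarith
  have k4 := (mul_eq_zero.1 k3).resolve_right hst'
  have hi := hub_ne i
  have hj := hub_ne j
  have la : lx a ≠ 0 := by fin_cases a <;> simp [lx]
  -- both lines are then parallel, and they meet only if they coincide
  have k5 : hh i * (lx b - lx a) * s = 0 ∨ True := Or.inr trivial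
  have k6 : lx a * (hh i * (1 - s)) = lx a * (hh j * (1 - s')) := by rw [e1']
  have k7 : hh i * (lx a * s) = hh i * (lx b * s') := by rw [e1]
  have k8 : lx a * hh j * s' = hh i * lx b * s' := by linear_combination s' * k4
  have k9 : lx a * (hh i - hh j) = 0 := by linear_combination k6 + k7 - k8
  have k10 := (mul_eq_zero.1 k9).resolve_left la
  have hij : hh i = hh j := by linarith
  have := hh_inj hij
  obtain ⟨-, ⟨-, h⟩ | ⟨-, h⟩⟩ := hc <;> exact absurd this (by have := Fin.lt_def.1 h; omega)

theorem once {n : ℕ} {x y : Ed n} {p q : ℝ × ℝ} (hne : x ≠ y) (h1 : opn x p) (h2 : opn y p)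
    (h3 : opn x q) (h4 : opn y q) : p = q := by
  rcases x with ⟨i, a⟩ | m <;> rcases y with ⟨j, b⟩ | m'
  · exact once_hh (fun h => hne (by rw [h])) h1 h2 h3 h4
  · exact once_hl h1 h2 h3 h4
  · exact once_hl h2 h1 h4 h3
  · exact absurd (by rw [cr_ll h1 h2]) hne

theorem far {n : ℕ} {i j : Fin n} {p : ℝ × ℝ} (h1 : opn (.inl (i, 3)) p) (h2 : opn (.inl (j, 4)) p) :
    2 ≤ p.1 := by
  have hc := cr_hh h1 h2 (by simp)
  have : i.val % 2 = j.val % 2 ∧ j < i := by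
    obtain ⟨h, h'⟩ := hc
    simp [inn] at h'
    exact ⟨h, h'⟩
  obtain ⟨s, s0, s1, rfl⟩ := h1
  obtain ⟨t, t0, t1, e⟩ := h2
  rw [Prod.mk.injEq] at e
  have := hub_double (by linarith) e.2 this.1 this.2
  have e1 := e.1
  simp [lx] at e1 ⊢
  linarith

theorem near {n : ℕ} {i : Fin n} {p : ℝ × ℝ} (h1 : opn (.inl (i, 2)) p) : p.1 < 2 := by
  obtain ⟨s, s0, s1, rfl⟩ := h1
  simp [lx]; linarith

instance inn_dec (a b : Fin 5) : Decidable (inn a b) := by unfold inn; infer_instance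

set_option synthInstance.maxHeartbeats 200000 in
set_option synthInstance.maxSize 1000 in
theorem inn_three : ∀ a b c : Fin 5, (inn a b ∨ inn b a) → (inn b c ∨ inn c b) → (inn a c ∨ inn c a) →
    (a = 2 ∧ b = 3 ∧ c = 4) ∨ (a = 2 ∧ b = 4 ∧ c = 3) ∨ (a = 3 ∧ b = 2 ∧ c = 4) ∨
    (a = 3 ∧ b = 4 ∧ c = 2) ∨ (a = 4 ∧ b = 2 ∧ c = 3) ∨ (a = 4 ∧ b = 3 ∧ c = 2) := by
  decide

theorem triple {n : ℕ} {x y z : Ed n} {p : ℝ × ℝ} (hxy : x ≠ y) (hyz : y ≠ z) (hxz : x ≠ z)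
    (h1 : opn x p) (h2 : opn y p) (h3 : opn z p) : False := by
  have c1 := cr_of h1 h2 hxy
  have c2 := cr_of h2 h3 hyz
  have c3 := cr_of h1 h3 hxz
  have hi : ∀ {i j : Fin n} {a b : Fin 5}, Cr (.inl (i, a)) (.inl (j, b)) → inn a b ∨ inn b a :=
    fun h => h.2.imp And.left And.left
  have two : ∀ {i j : Fin n} {a b : Fin 5} {m : Fin 6}, CrH i a m → CrH j b m →
      Cr (.inl (i, a)) (.inl (j, b)) → False := by
    intro i j a b m g1 g2 g3
    have g3 := hi g3
    rcases g1 with ⟨-, rfl, rfl⟩ | ⟨-, rfl, rfl⟩ <;> rcases g2 with ⟨-, rfl, g⟩ | ⟨-, rfl, g⟩ <;>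
      revert g g3 <;> unfold inn <;> decide
  rcases x with ⟨i, a⟩ | m <;> rcases y with ⟨j, b⟩ | m' <;> rcases z with ⟨k, c⟩ | m''
  · have := inn_three a b c (hi c1) (hi c2) (hi c3)
    rcases this with ⟨rfl, rfl, rfl⟩ | ⟨rfl, rfl, rfl⟩ | ⟨rfl, rfl, rfl⟩ | ⟨rfl, rfl, rfl⟩ |
      ⟨rfl, rfl, rfl⟩ | ⟨rfl, rfl, rfl⟩
    · exact absurd (far h2 h3) (not_le.2 (near h1))
    · exact absurd (far h3 h2) (not_le.2 (near h1))
    · exact absurd (far h1 h3) (not_le.2 (near h2))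
    · exact absurd (far h1 h2) (not_le.2 (near h3))
    · exact absurd (far h3 h1) (not_le.2 (near h2))
    · exact absurd (far h2 h1) (not_le.2 (near h3))
  · exact two c3 c2 c1
  · exact two c1 c2 c3
  · exact c2
  · exact two c1 c3 c2
  · exact c3
  · exact c1
  · exact c1

def pos' {n : ℕ} : Fin 5 ⊕ Fin n → ℝ × ℝ
  | .inl a => (lx a, 0)
  | .inr i => (0, hh i)

theorem opn_pos {n : ℕ} {x : Ed n} {v : Fin 5 ⊕ Fin n} (h : opn x (pos' v)) : False := by
  rcases x with ⟨i, a⟩ | m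
  · obtain ⟨s, s0, s1, e⟩ := h
    rcases v with c | j <;> simp only [pos', Prod.mk.injEq] at e
    · exact mul_ne_zero (hub_ne i) (by linarith) e.2.symm
    · have hl : lx a ≠ 0 := by fin_cases a <;> simp [lx]
      exact mul_ne_zero hl s0.ne' e.1.symm
  · obtain ⟨x1, x2, hy⟩ := h
    rcases v with c | j <;> simp only [pos'] at x1 x2 hy
    · have q1 : 0 < (lx c - lx (LP m)) * (lx (LQ m) - lx c) := mul_pos (by linarith) (by linarith)
      have hm := (mul_eq_zero.1 hy.symm).resolve_right q1.ne'
      clear q1 hy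
      fin_cases m <;> simp [LK, LP, LQ] at hm x1 x2 <;> revert x1 x2 <;> fin_cases c <;>
        simp [lx] <;> intros <;> linarith
    · have hM := hub_M j.2
      have hs := hub_side j
      have hM1 := one_le_two_pow' n
      generalize hh j = h at *
      fin_cases m <;> simp [LK, LP, LQ, lx] at hy x1 x2 <;>
        (rcases hs with hs | hs <;> linarith [hs.2])

theorem pos'_inj {n : ℕ} : Function.Injective (pos' (n := n)) := by
  have hl : ∀ a, lx a ≠ 0 := by intro a; fin_cases a <;> simp [lx]
  have hli : Function.Injective lx := by
    intro a b; fin_cases a <;> fin_cases b <;> simp [lx] <;> norm_num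
  rintro (a | i) (b | j) h <;> simp only [pos', Prod.mk.injEq] at h
  · rw [hli h.1]
  · exact absurd h.1 (hl a)
  · exact absurd h.1.symm (hl b)
  · rw [Fin.ext (hh_inj h.2)]

end Upper2

section Upper3

def pt : Fin 5 → Bool := ![true, false, false, true, false]

def adj5 {n : ℕ} : Fin 5 ⊕ Fin n → Fin 5 ⊕ Fin n → Prop
  | .inl a, .inl b => pt a ≠ pt b
  | .inl _, .inr _ => True
  | .inr _, .inl _ => True
  | .inr _, .inr _ => False

noncomputable def KK (n : ℕ) (a b : Fin 5) : ℝ :=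
  if (a = 0 ∧ b = 2) ∨ (a = 2 ∧ b = 0) then -(1/100)
  else if (a = 0 ∧ b = 4) ∨ (a = 4 ∧ b = 0) then 2 ^ n
  else if (a = 1 ∧ b = 3) ∨ (a = 3 ∧ b = 1) then 1/100 else 0

theorem KK_symm (n : ℕ) (a b : Fin 5) : KK n a b = KK n b a := by
  fin_cases a <;> fin_cases b <;> simp [KK]

noncomputable def kap {n : ℕ} : Fin 5 ⊕ Fin n → Fin 5 ⊕ Fin n → ℝ
  | .inl a, .inl b => KK n a b * (lx b - lx a) ^ 2
  | .inl _, .inr _ => 0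
  | .inr _, .inl _ => 0
  | .inr _, .inr _ => 0

theorem kap_symm {n : ℕ} (u v : Fin 5 ⊕ Fin n) : kap u v = kap v u := by
  rcases u with a | i <;> rcases v with b | j <;> simp only [kap]
  rw [KK_symm]; ring

noncomputable def arc5 {n : ℕ} (u v : Fin 5 ⊕ Fin n) (t : ℝ) : ℝ × ℝ :=
  ((1 - t) * (pos' u).1 + t * (pos' v).1,
    (1 - t) * (pos' u).2 + t * (pos' v).2 + kap u v * (t * (1 - t)))

theorem arc5_symm {n : ℕ} (u v : Fin 5 ⊕ Fin n) (t : ℝ) : arc5 v u t = arc5 u v (1 - t) := by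
  unfold arc5
  rw [kap_symm v u]
  ext <;> simp only <;> ring

def src {n : ℕ} : Ed n → Fin 5 ⊕ Fin n
  | .inl (i, _) => .inr i
  | .inr m => .inl (LP m)

def tgt {n : ℕ} : Ed n → Fin 5 ⊕ Fin n
  | .inl (_, a) => .inl a
  | .inr m => .inl (LQ m)

theorem arc_opn {n : ℕ} (x : Ed n) {t : ℝ} (h0 : 0 < t) (h1 : t < 1) : opn x (arc5 (src x) (tgt x) t) := by
  rcases x with ⟨i, a⟩ | m
  · refine ⟨t, h0, h1, ?_⟩
    unfold arc5
    ext <;> simp only [src, tgt, pos', kap] <;> ring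
  · have hlt : lx (LP m) < lx (LQ m) := by fin_cases m <;> simp [LP, LQ, lx] <;> norm_num
    have hK : KK n (LP m) (LQ m) = LK n m := by fin_cases m <;> simp [LP, LQ, KK, LK]
    unfold arc5
    simp only [src, tgt, pos', kap, hK]
    refine ⟨?_, ?_, ?_⟩
    · simp only; nlinarith
    · simp only; nlinarith
    · simp only; ring

theorem pt_cases : ∀ a b : Fin 5, pt a ≠ pt b → ∃ m : Fin 6, (LP m = a ∧ LQ m = b) ∨ (LP m = b ∧ LQ m = a) := by
  decide

theorem adj_cases {n : ℕ} {u v : Fin 5 ⊕ Fin n} (h : adj5 u v) :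
    ∃ x : Ed n, (src x = u ∧ tgt x = v) ∨ (src x = v ∧ tgt x = u) := by
  rcases u with a | i <;> rcases v with b | j
  · obtain ⟨m, h | h⟩ := pt_cases a b h
    · exact ⟨.inr m, .inl ⟨by rw [src, h.1], by rw [tgt, h.2]⟩⟩
    · exact ⟨.inr m, .inr ⟨by rw [src, h.1], by rw [tgt, h.2]⟩⟩
  · exact ⟨.inl (j, a), .inr ⟨rfl, rfl⟩⟩
  · exact ⟨.inl (i, b), .inl ⟨rfl, rfl⟩⟩
  · exact h.elim

theorem adj_opn {n : ℕ} {u v : Fin 5 ⊕ Fin n} (h : adj5 u v) :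
    ∃ x : Ed n, s(u, v) = s(src x, tgt x) ∧ ∀ t, 0 < t → t < 1 → opn x (arc5 u v t) := by
  obtain ⟨x, ⟨rfl, rfl⟩ | ⟨rfl, rfl⟩⟩ := adj_cases h
  · exact ⟨x, rfl, fun t h0 h1 => arc_opn x h0 h1⟩
  · refine ⟨x, Sym2.eq_swap, fun t h0 h1 => ?_⟩
    rw [arc5_symm]
    exact arc_opn x (by linarith) (by linarith)

theorem lx_inj : Function.Injective lx := by
  intro a b; fin_cases a <;> fin_cases b <;> simp [lx] <;> norm_num

theorem adj_fst {n : ℕ} {u v : Fin 5 ⊕ Fin n} (h : adj5 u v) : (pos' u).1 ≠ (pos' v).1 := by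
  have hl : ∀ a, lx a ≠ 0 := by intro a; fin_cases a <;> simp [lx]
  rcases u with a | i <;> rcases v with b | j
  · exact lx_inj.ne (fun e => h (by rw [e]))
  · exact hl a
  · exact (hl b).symm
  · exact h.elim

theorem arc5_zero {n : ℕ} (u v : Fin 5 ⊕ Fin n) : arc5 u v 0 = pos' u := by
  unfold arc5; ext <;> simp
theorem arc5_one {n : ℕ} (u v : Fin 5 ⊕ Fin n) : arc5 u v 1 = pos' v := by
  unfold arc5; ext <;> simp

variable {W : Type*} {G : SimpleGraph W} {n : ℕ}

noncomputable def drw (cl : W ≃ Fin 5 ⊕ Fin n) (hcl : ∀ u v, G.Adj u v → adj5 (cl u) (cl v)) :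
    Drawing G where
  pos u := pos' (cl u)
  pos_inj := pos'_inj.comp cl.injective
  arc u v := arc5 (cl u) (cl v)
  arc_cont := by
    intro u v _
    apply Continuous.continuousOn
    unfold arc5
    fun_prop
  arc_zero := fun u v _ => arc5_zero _ _
  arc_one := fun u v _ => arc5_one _ _
  arc_symm := fun u v _ t => arc5_symm _ _ t
  arc_avoid := by
    rintro u v h c hu hv ⟨t, ⟨h0, h1⟩, e⟩
    rcases h0.eq_or_lt with rfl | h0
    · rw [arc5_zero] at e
      exact hu (cl.injective (pos'_inj e.symm))
    rcases h1.eq_or_lt with rfl | h1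
    · rw [arc5_one] at e
      exact hv (cl.injective (pos'_inj e.symm))
    obtain ⟨x, -, hx⟩ := adj_opn (hcl u v h)
    have := hx t h0 h1
    rw [e] at this
    exact opn_pos this

def ed (cl : W ≃ Fin 5 ⊕ Fin n) (x : Ed n) : Sym2 W := s(cl.symm (src x), cl.symm (tgt x))

theorem edge_x (cl : W ≃ Fin 5 ⊕ Fin n) (hcl : ∀ u v, G.Adj u v → adj5 (cl u) (cl v)) (e : Sym2 W)
    (he : e ∈ G.edgeSet) : ∃ x, e = ed cl x ∧ ∀ p, p ∈ (drw cl hcl).edgePoints e →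
      p ∉ (drw cl hcl).ends e → opn x p := by
  induction e with
  | _ u v =>
  rw [SimpleGraph.mem_edgeSet] at he
  obtain ⟨x, hx, ho⟩ := adj_opn (hcl u v he)
  refine ⟨x, ?_, ?_⟩
  · have := congrArg (Sym2.map cl.symm) hx
    simpa [Sym2.map_mk, ed] using this
  · rintro p ⟨a, b, hab, hadj, t, ⟨h0, h1⟩, rfl⟩ hne
    rcases h0.eq_or_lt with rfl | h0
    · exact absurd ⟨a, by rw [hab]; simp, (drw cl hcl).arc_zero hadj⟩ hne
    rcases h1.eq_or_lt with rfl | h1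
    · exact absurd ⟨b, by rw [hab]; simp, (drw cl hcl).arc_one hadj⟩ hne
    rw [Sym2.eq_iff] at hab
    rcases hab with ⟨rfl, rfl⟩ | ⟨rfl, rfl⟩
    · exact ho t h0 h1
    · rw [(drw cl hcl).arc_symm he]
      exact ho _ (by linarith) (by linarith)

theorem cr_adj {x y : Ed n} (h : Cr x y) {v : Fin 5 ⊕ Fin n} (h1 : v ∈ s(src x, tgt x))
    (h2 : v ∈ s(src y, tgt y)) : False := by
  rw [Sym2.mem_iff] at h1 h2
  have key : ∀ {i : Fin n} {a : Fin 5} {m : Fin 6}, CrH i a m → v = Sum.inr i ∨ v = Sum.inl a →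
      v = Sum.inl (LP m) ∨ v = Sum.inl (LQ m) → False := by
    rintro i a m hc (rfl | rfl) h2
    · simp at h2
    · simp only [Sum.inl.injEq] at h2
      rcases hc with ⟨-, rfl, rfl⟩ | ⟨-, rfl, rfl⟩ <;> revert h2 <;> decide
  rcases x with ⟨i, a⟩ | m <;> rcases y with ⟨j, b⟩ | m' <;> simp only [src, tgt] at h1 h2
  · obtain ⟨-, h⟩ := h
    have hab : a ≠ b := by
      rintro rfl
      rcases h with h | h <;> revert h <;> unfold inn <;> revert a <;> intro a _ _ <;>
        rintro ⟨h, -⟩ <;> omega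
    have hij : i ≠ j := by
      rintro rfl
      rcases h with h | h <;> exact lt_irrefl _ h.2
    rcases h1 with rfl | rfl <;> simp at h2
    · exact hij h2
    · exact hab h2
  · exact key h h1 h2
  · exact key h h2 h1
  · exact h

theorem drw_good (cl : W ≃ Fin 5 ⊕ Fin n) (hcl : ∀ u v, G.Adj u v → adj5 (cl u) (cl v)) :
    (drw cl hcl).IsGood where
  arc_inj := by
    intro u v h t _ t' _ e
    have e1 := congrArg Prod.fst e
    simp only [drw, arc5] at e1
    have h1 := adj_fst (hcl u v h)
    have : (t - t') * ((pos' (cl v)).1 - (pos' (cl u)).1) = 0 := by linarith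
    have := (mul_eq_zero.1 this).resolve_right (sub_ne_zero.2 h1.symm)
    linarith
  adj_no_cross := by
    rintro e f ⟨a, hae, haf⟩ p ⟨h1, h2, h3, h4, h5, h6, h7⟩
    obtain ⟨x, rfl, hx⟩ := edge_x cl hcl e h1
    obtain ⟨y, rfl, hy⟩ := edge_x cl hcl f h2
    have hne : x ≠ y := fun e => h3 (by rw [e])
    have hc := cr_of (hx p h4 h6) (hy p h5 h7) hne
    simp only [ed, Sym2.mem_iff, Equiv.eq_symm_apply] at hae haf
    exact cr_adj hc (v := cl a) (Sym2.mem_iff.2 hae) (Sym2.mem_iff.2 haf)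
  cross_once := by
    rintro e f p ⟨h1, h2, h3, h4, h5, h6, h7⟩ q ⟨-, -, -, g4, g5, g6, g7⟩
    obtain ⟨x, rfl, hx⟩ := edge_x cl hcl e h1
    obtain ⟨y, rfl, hy⟩ := edge_x cl hcl f h2
    have hne : x ≠ y := fun e => h3 (by rw [e])
    exact once hne (hx p h4 h6) (hy p h5 h7) (hx q g4 g6) (hy q g5 g7)
  no_triple := by
    rintro p e f g hef heg hfg ⟨⟨h1, h2, h3, h4, h5, h6, h7⟩, ⟨-, k2, k3, k4, k5, k6, k7⟩, -⟩
    obtain ⟨x, rfl, hx⟩ := edge_x cl hcl e h1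
    obtain ⟨y, rfl, hy⟩ := edge_x cl hcl f h2
    obtain ⟨z, rfl, hz⟩ := edge_x cl hcl g k2
    exact triple (fun e => hef (by rw [e])) (fun e => hfg (by rw [e])) (fun e => heg (by rw [e]))
      (hx p h4 h6) (hy p h5 h7) (hz p k5 k7)

abbrev CI (n : ℕ) := ((Σ j : Fin n, Fin (j.val / 2)) × Fin 4) ⊕ Fin n

theorem sum_half (n : ℕ) : ∑ j ∈ Finset.range n, j / 2 = (n / 2) * ((n - 1) / 2) := by
  induction n with
  | zero => rfl
  | succ m ih =>
    rw [Finset.sum_range_succ, ih]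
    obtain ⟨k, rfl | rfl⟩ := Nat.even_or_odd' m
    · rcases k with _ | k
      · rfl
      rw [show 2 * (k + 1) / 2 = k + 1 by omega, show (2 * (k + 1) - 1) / 2 = k by omega,
        show (2 * (k + 1) + 1) / 2 = k + 1 by omega, show (2 * (k + 1) + 1 - 1) / 2 = k + 1 by omega]
      ring
    · rw [show (2 * k + 1) / 2 = k by omega, show (2 * k + 1 - 1) / 2 = k by omega,
        show (2 * k + 1 + 1) / 2 = k + 1 by omega, show (2 * k + 1 + 1 - 1) / 2 = k by omega]
      ring

theorem card_CI (n : ℕ) : Fintype.card (CI n) = z5 n + n := by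
  simp only [CI, Fintype.card_sum, Fintype.card_prod, Fintype.card_sigma, Fintype.card_fin]
  rw [Fin.sum_univ_eq_sum_range (fun j => j / 2) n, sum_half, z5]
  ring

def inA : Fin 4 → Fin 5 := ![1, 2, 2, 3]
def inB : Fin 4 → Fin 5 := ![0, 3, 4, 4]

theorem inn_ex : ∀ a b : Fin 5, inn a b → ∃ m : Fin 4, inA m = a ∧ inB m = b := by decide

/-- list of crossing pairs -/
def cpair (cl : W ≃ Fin 5 ⊕ Fin n) : CI n → Sym2 (Sym2 W)
  | .inl (⟨j, k⟩, m) => s(ed cl (.inl (j, inA m)),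
      ed cl (.inl (⟨j.val - 2 * (k.val + 1), by have := j.2; omega⟩, inB m)))
  | .inr i => if i.val % 2 = 0 then s(ed cl (.inl (i, 2)), ed cl (.inr 3))
      else s(ed cl (.inl (i, 1)), ed cl (.inr 1))

theorem cr_cpair (cl : W ≃ Fin 5 ⊕ Fin n) {x y : Ed n} (h : Cr x y) :
    ∃ c, cpair cl c = s(ed cl x, ed cl y) := by
  have kh : ∀ {i : Fin n} {a : Fin 5} {m : Fin 6}, CrH i a m →
      ∃ c, cpair cl c = s(ed cl (.inl (i, a)), ed cl (.inr m)) := by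
    rintro i a m (⟨hi, rfl, rfl⟩ | ⟨hi, rfl, rfl⟩)
    · exact ⟨.inr i, by simp only [cpair, hi, if_true]⟩
    · exact ⟨.inr i, by simp only [cpair, hi]; rfl⟩
  have kk : ∀ {i j : Fin n} {a b : Fin 5}, i.val % 2 = j.val % 2 → inn a b → j < i →
      ∃ c, cpair cl c = s(ed cl (.inl (i, a)), ed cl (.inl (j, b))) := by
    intro i j a b hp hab hji
    obtain ⟨m, rfl, rfl⟩ := inn_ex a b hab
    rw [Fin.lt_def] at hji
    refine ⟨.inl (⟨i, ⟨(i.val - j.val) / 2 - 1, by omega⟩⟩, m), ?_⟩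
    simp only [cpair]
    have : (⟨i.val - 2 * ((i.val - j.val) / 2 - 1 + 1), by have := i.2; omega⟩ : Fin n) = j := by
      apply Fin.ext; simp only; omega
    rw [this]
  rcases x with ⟨i, a⟩ | m <;> rcases y with ⟨j, b⟩ | m'
  · obtain ⟨hp, ⟨h1, h2⟩ | ⟨h1, h2⟩⟩ := h
    · exact kk hp h1 h2
    · rw [Sym2.eq_swap]; exact kk hp.symm h1 h2
  · exact kh h
  · rw [Sym2.eq_swap]; exact kh h
  · exact h.elim

theorem upper (cl : W ≃ Fin 5 ⊕ Fin n) (hcl : ∀ u v, G.Adj u v → adj5 (cl u) (cl v)) :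
    ∃ D : Drawing G, D.IsGood ∧ D.crNum ≤ z5 n + n := by
  refine ⟨drw cl hcl, drw_good cl hcl, ?_⟩
  rw [crNum_eq (drw_good cl hcl), ← card_CI, ← Nat.card_eq_fintype_card]
  have hsub : crPairs (drw cl hcl) ⊆ Set.range (cpair cl) := by
    rintro q ⟨e, f, p, rfl, h1, h2, h3, h4, h5, h6, h7⟩
    obtain ⟨x, rfl, hx⟩ := edge_x cl hcl e h1
    obtain ⟨y, rfl, hy⟩ := edge_x cl hcl f h2
    have hne : x ≠ y := fun e => h3 (by rw [e])
    exact cr_cpair cl (cr_of (hx p h4 h6) (hy p h5 h7) hne)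
  refine (Set.ncard_le_ncard hsub (Set.finite_range _)).trans ?_
  rw [← Nat.card_coe_set_eq]
  exact Finite.card_range_le _

end Upper3

section Final

def cl23 (n : ℕ) : (Σ i : Fin 3, ![Fin 2, Fin 3, Fin n] i) → Fin 5 ⊕ Fin n
  | ⟨0, x⟩ => Sum.inl ((![0, 3] : Fin 2 → Fin 5) x)
  | ⟨1, x⟩ => Sum.inl ((![1, 2, 4] : Fin 3 → Fin 5) x)
  | ⟨2, x⟩ => Sum.inr x

def emb23 (n : ℕ) : Emb (triK 2 3 n) n where
  hub i := ⟨2, i⟩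
  leaf := ![⟨0, (0 : Fin 2)⟩, ⟨0, (1 : Fin 2)⟩, ⟨1, (0 : Fin 3)⟩, ⟨1, (1 : Fin 3)⟩, ⟨1, (2 : Fin 3)⟩]
  hub_inj := by
    intro i j h
    exact Sum.inr.inj (congrArg (cl23 n) h)
  leaf_inj := by
    intro a b h
    replace h := congrArg (cl23 n) h
    fin_cases a <;> fin_cases b <;> first | rfl | (exfalso; revert h; simp [cl23])
  hl := by
    intro i a
    fin_cases a <;> first | exact (by decide : (2 : Fin 3) ≠ 0) | exact (by decide : (2 : Fin 3) ≠ 1) | exact (by decide : (0 : Fin 3) ≠ 1)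
  ll := by
    intro p q hp hq
    fin_cases p <;> fin_cases q <;> first | (exfalso; revert hp; decide) | (exfalso; revert hq; decide) | first | exact (by decide : (2 : Fin 3) ≠ 0) | exact (by decide : (2 : Fin 3) ≠ 1) | exact (by decide : (0 : Fin 3) ≠ 1)

theorem cl23_bij (n : ℕ) : Function.Bijective (cl23 n) := by
  constructor
  · rintro ⟨i, x⟩ ⟨j, y⟩ h
    fin_cases i <;> fin_cases j <;> simp [cl23] at h ⊢
    · change Fin 2 at x; change Fin 2 at y
      fin_cases x <;> fin_cases y <;> first | rfl | (exfalso; revert h; decide)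
    · change Fin 2 at x; change Fin 3 at y
      fin_cases x <;> fin_cases y <;> (revert h; decide)
    · change Fin 3 at x; change Fin 2 at y
      fin_cases x <;> fin_cases y <;> (revert h; decide)
    · change Fin 3 at x; change Fin 3 at y
      fin_cases x <;> fin_cases y <;> first | rfl | (exfalso; revert h; decide)
    · exact heq_of_eq (Sum.inr.inj h)
  · rintro (a | i)
    · fin_cases a
      · exact ⟨⟨0, (0 : Fin 2)⟩, rfl⟩
      · exact ⟨⟨1, (0 : Fin 3)⟩, rfl⟩
      · exact ⟨⟨1, (1 : Fin 3)⟩, rfl⟩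
      · exact ⟨⟨0, (1 : Fin 2)⟩, rfl⟩
      · exact ⟨⟨1, (2 : Fin 3)⟩, rfl⟩
    · exact ⟨⟨2, i⟩, rfl⟩

theorem cl23_adj (n : ℕ) (u v : Σ i : Fin 3, ![Fin 2, Fin 3, Fin n] i)
    (h : (triK 2 3 n).Adj u v) : adj5 (cl23 n u) (cl23 n v) := by
  have h' : u.1 ≠ v.1 := h
  clear h
  obtain ⟨i, x⟩ := u
  obtain ⟨j, y⟩ := v
  fin_cases i <;> fin_cases j <;> first | exact absurd rfl h' | exact trivial | skip
  · change Fin 2 at x; change Fin 3 at y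
    fin_cases x <;> fin_cases y <;> simp [adj5, cl23, pt]
  · change Fin 3 at x; change Fin 2 at y
    fin_cases x <;> fin_cases y <;> simp [adj5, cl23, pt]

theorem Z_eq (n : ℕ) (hn : 0 < n) : Z 5 (n + 2) = z5 n + n + 3 * n := by
  unfold Z z5
  rcases Nat.even_or_odd' n with ⟨k, rfl | rfl⟩
  · obtain ⟨m, rfl⟩ : ∃ m, k = m + 1 := ⟨k - 1, by omega⟩
    rw [show (2 * (m + 1) + 2) / 2 = m + 2 by omega, show (2 * (m + 1) + 2 - 1) / 2 = m + 1 by omega,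
      show (2 * (m + 1)) / 2 = m + 1 by omega, show (2 * (m + 1) - 1) / 2 = m by omega]
    norm_num; ring
  · rw [show (2 * k + 1 + 2) / 2 = k + 1 by omega, show (2 * k + 1 + 2 - 1) / 2 = k + 1 by omega,
      show (2 * k + 1) / 2 = k by omega, show (2 * k + 1 - 1) / 2 = k by omega]
    norm_num; ring

end Final

/-- For every positive integer `n`, the crossing number of the complete
tripartite graph `K_{2,3,n}` equals `Z(5,n+2) − 3n`. -/
theorem statement13 (n : ℕ) (hn : 0 < n) :
    (crossingNumber (triK 2 3 n) : ℤ) = (Z 5 (n + 2) : ℤ) - 3 * (n : ℤ) := by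
  have hfin : Finite (Σ i : Fin 3, ![Fin 2, Fin 3, Fin n] i) :=
    Finite.of_injective _ (cl23_bij n).1
  obtain ⟨D, hD, hle⟩ := upper (G := triK 2 3 n) (Equiv.ofBijective _ (cl23_bij n)) (cl23_adj n)
  have h1 : crossingNumber (triK 2 3 n) ≤ z5 n + n :=
    le_trans (Nat.sInf_le ⟨D, hD, rfl⟩) hle
  have h2 : z5 n + n ≤ crossingNumber (triK 2 3 n) := by
    obtain ⟨D', hD', he⟩ := Nat.sInf_mem
      (s := {m | ∃ D : Drawing (triK 2 3 n), D.IsGood ∧ D.crNum = m}) ⟨_, D, hD, rfl⟩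
    have := lower (emb23 n) hn hD'
    unfold crossingNumber
    rw [← he]
    exact this
  have h3 := Z_eq n hn
  omega
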